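/- Let k be any field and let K be a function field over k. For each integer D ≥ 1 there exists a bound B = B(D) such that: for any finite field extension L/K with [L : K] ≤ D and any quadratic polynomial f ∈ L[z] (deg f = 2) that is not conjugate, by any affine map γ(z) = az + b with a, b in an algebraic closure L̄ of L and a ≠ 0, to a polynomial with coefficients in the algebraic closure of k inside L̄, the number of preperiodic points of f in P¹(L) is at most B. -/

import Mathlib

open Polynomial

/-- A point is preperiodic for a self-map if its forward orbit is finite. -/
def IsPreperiodic {S : Type*} (f : S → S) (x : S) : Prop :=
  (Set.range fun n : ℕ => f^[n] x).Finite

/-- The action of a polynomial on `P¹(L) = L ∪ {∞}`, with `none` playing the role of `∞`. -/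
def polyP1Map {L : Type*} [Field L] (f : Polynomial L) : Option L → Option L
  | none => none
  | some x => some (f.eval x)

open scoped Classical in
/-- The self-map of `P¹(F) = F ∪ {∞}` induced by the rational function `p/q`. -/
noncomputable def ratP1Map {F : Type*} [Field F] (p q : Polynomial F) :
    Option F → Option F
  | none =>
      if q.degree < p.degree then none
      else if p.degree < q.degree then some 0
      else some (p.leadingCoeff / q.leadingCoeff)
  | some x => if q.eval x = 0 then none else some (p.eval x / q.eval x)

/-- The Möbius transformation `z ↦ (az + b)/(cz + d)` as a self-map of `P¹(F)`. -/
noncomputable def mobiusMap {F : Type*} [Field F] (a b c d : F) : Option F → Option F :=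
  ratP1Map (C a * X + C b) (C c * X + C d)

/-- `x` is algebraic over the image of `ι`. -/
def AlgebraicOver {k F : Type*} [Field k] [Field F] (ι : k →+* F) (x : F) : Prop :=
  ∃ p : Polynomial k, p ≠ 0 ∧ (p.map ι).IsRoot x

/-- A self-map `g` of `P¹(F)` is isotrivial over `k` (w.r.t. `ι : k →+* F`, `F` playing the
role of an algebraic closure of `L`) if some Möbius conjugate `γ⁻¹ ∘ g ∘ γ` of `g` is given by a
rational function all of whose coefficients are algebraic over `k`. -/
def IsotrivialMap {k F : Type*} [Field k] [Field F] (ι : k →+* F)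
    (g : Option F → Option F) : Prop :=
  ∃ a b c d : F, a * d - b * c ≠ 0 ∧
    ∃ p q : Polynomial F, q ≠ 0 ∧
      (∀ n, AlgebraicOver ι (p.coeff n)) ∧ (∀ n, AlgebraicOver ι (q.coeff n)) ∧
      (mobiusMap d (-b) (-c) a) ∘ g ∘ (mobiusMap a b c d) = ratP1Map p q


section gauss
variable {E : Type*} [Field E] {G0 : Type*} [LinearOrderedCommGroupWithZero G0]

/-- Gauss norm of a polynomial with respect to a valuation. -/
noncomputable def gn (v : Valuation E G0) (P : E[X]) : G0 := P.support.sup (fun i => v (P.coeff i))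

lemma gn_coeff_le (v : Valuation E G0) (P : E[X]) (i : ℕ) : v (P.coeff i) ≤ gn v P := by
  by_cases h : i ∈ P.support
  · exact Finset.le_sup (f := fun i => v (P.coeff i)) h
  · rw [notMem_support_iff] at h
    simp [h]

lemma gn_le (v : Valuation E G0) (P : E[X]) (c : G0) (h : ∀ i, v (P.coeff i) ≤ c) : gn v P ≤ c :=
  Finset.sup_le fun i _ => h i

lemma gn_attained (v : Valuation E G0) (P : E[X]) : ∃ i, v (P.coeff i) = gn v P := by
  by_cases hP : P = 0
  · exact ⟨0, by simp [hP, gn, bot_eq_zero]⟩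
  · obtain ⟨i, _, hi⟩ := Finset.exists_mem_eq_sup P.support (by simpa using hP)
      (fun i => v (P.coeff i))
    exact ⟨i, hi.symm⟩

lemma gn_pos (v : Valuation E G0) (P : E[X]) (hP : P ≠ 0) : 0 < gn v P := by
  have h1 := gn_coeff_le v P P.natDegree
  refine lt_of_lt_of_le ?_ h1
  rw [zero_lt_iff, Valuation.ne_zero_iff]
  simpa using hP

lemma gn_mul (v : Valuation E G0) (P Q : E[X]) : gn v (P * Q) = gn v P * gn v Q := by
  classical
  by_cases hP : P = 0
  · simp [hP, gn, bot_eq_zero]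
  by_cases hQ : Q = 0
  · simp [hQ, gn, bot_eq_zero]
  apply le_antisymm
  · apply gn_le
    intro i
    rw [coeff_mul]
    apply Valuation.map_sum_le
    intro x _
    rw [map_mul]
    exact mul_le_mul' (gn_coeff_le v P _) (gn_coeff_le v Q _)
  · have ha := gn_attained v P
    have hb := gn_attained v Q
    let a := Nat.find ha
    let b := Nat.find hb
    have ha1 : v (P.coeff a) = gn v P := Nat.find_spec ha
    have hb1 : v (Q.coeff b) = gn v Q := Nat.find_spec hb
    have ha2 : ∀ i < a, v (P.coeff i) < gn v P := fun i hi =>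
      lt_of_le_of_ne (gn_coeff_le v P i) (Nat.find_min ha hi)
    have hb2 : ∀ i < b, v (Q.coeff i) < gn v Q := fun i hi =>
      lt_of_le_of_ne (gn_coeff_le v Q i) (Nat.find_min hb hi)
    have key : v ((P * Q).coeff (a + b)) = gn v P * gn v Q := by
      rw [coeff_mul, ← Finset.add_sum_erase _ _ (Finset.HasAntidiagonal.mem_antidiagonal.2 (rfl : (a, b).1 + (a, b).2 = a + b))]
      rw [Valuation.map_add_eq_of_lt_left]
      · rw [map_mul, ha1, hb1]
      · rw [map_mul]
        simp only [ha1, hb1]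
        apply Valuation.map_sum_lt
        · exact (mul_pos (gn_pos v P hP) (gn_pos v Q hQ)).ne'
        · intro x hx
          rw [Finset.mem_erase, Finset.HasAntidiagonal.mem_antidiagonal] at hx
          rw [map_mul]
          rcases lt_trichotomy x.1 a with h | h | h
          · exact mul_lt_mul_of_lt_of_le_of_nonneg_of_pos (ha2 _ h) (gn_coeff_le v Q _) zero_le (gn_pos v Q hQ)
          · exfalso
            apply hx.1
            ext
            · exact h
            · simp only; omega
          · have : x.2 < b := by omega
            rw [mul_comm, mul_comm (gn v P)]
            exact mul_lt_mul_of_lt_of_le_of_nonneg_of_pos (hb2 _ this) (gn_coeff_le v P _) zero_le (gn_pos v P hP)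
    rw [← key]
    exact gn_coeff_le _ _ _


lemma gn_C (v : Valuation E G0) (c : E) : gn v (C c) = v c := by
  apply le_antisymm
  · apply gn_le
    intro i
    rw [coeff_C]
    split_ifs <;> simp
  · simpa using gn_coeff_le v (C c) 0

lemma gn_one (v : Valuation E G0) : gn v (1 : E[X]) = 1 := by
  rw [← C_1, gn_C, map_one]

lemma gn_pow (v : Valuation E G0) (P : E[X]) (n : ℕ) : gn v (P ^ n) = gn v P ^ n := by
  induction n with
  | zero => simp [gn_one]
  | succ n ih => rw [pow_succ, gn_mul, ih, pow_succ]

lemma gn_prod (v : Valuation E G0) {ι : Type*} (s : Finset ι) (P : ι → E[X]) :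
    gn v (∏ i ∈ s, P i) = ∏ i ∈ s, gn v (P i) := by
  classical
  induction s using Finset.induction_on with
  | empty => simp [gn_one]
  | insert a s ha ih => rw [Finset.prod_insert ha, gn_mul, ih, Finset.prod_insert ha]

lemma one_le_gn (v : Valuation E G0) (P : E[X]) (hP : P.Monic) : 1 ≤ gn v P := by
  have := gn_coeff_le v P P.natDegree
  rwa [coeff_natDegree, hP.leadingCoeff, map_one] at this

lemma isIntegral_of_forall_valuation {A : Type*} [CommRing A] [Algebra A E] (y : E)
    (h : ∀ V : ValuationSubring E, (∀ a : A, algebraMap A E a ∈ V) → y ∈ V) :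
    IsIntegral A y := by
  have h1 := iInf_valuationSubring_superset (s := Set.range (algebraMap A E))
  have h2 : y ∈ (⨅ V : {V : ValuationSubring E // Set.range (algebraMap A E) ⊆ V.toSubring}, V.1.toSubring) := by
    rw [Subring.mem_iInf]
    rintro ⟨V, hV⟩
    exact h V fun a => hV ⟨a, rfl⟩
  rw [h1] at h2
  have h3 : Subring.closure (Set.range (algebraMap A E)) = (algebraMap A E).range := by
    rw [← RingHom.coe_range, Subring.closure_eq]
  have h5 : IsIntegral (algebraMap A E).range y := by
    have h6 : y ∈ integralClosure (Subring.closure (Set.range (algebraMap A E))) E := h2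
    rw [h3] at h6
    exact h6
  obtain ⟨Q, hQ, hQ2⟩ := h5
  obtain ⟨R, hR1, _, hR2⟩ := Polynomial.lifts_and_natDegree_eq_and_monic
    ((Polynomial.mem_lifts Q).2 (Polynomial.map_surjective _ (algebraMap A E).rangeRestrict_surjective Q)) hQ
  refine ⟨R, hR2, ?_⟩
  rw [← hR1, eval₂_map] at hQ2
  exact hQ2

end gauss


section core1

lemma exp_one_le_of_one_lt (c : WithZero (Multiplicative ℤ)) (h : 1 < c) :
    WithZero.exp (1:ℤ) ≤ c := by
  have hc : c ≠ 0 := (zero_lt_one.trans h).ne'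
  rw [← WithZero.exp_log hc] at h ⊢
  rw [← WithZero.exp_zero, WithZero.exp_lt_exp] at h
  rw [WithZero.exp_le_exp]
  omega

lemma exists_primitive_multiple {k κ : Type*} [Field k] [Field κ] [Algebra k[X] κ]
    [IsFractionRing k[X] κ] (M : κ[X]) (hM : M.Monic) :
    ∃ (Mt : k[X][X]) (h : k[X]), h ≠ 0 ∧ Mt.IsPrimitive ∧
      Mt.map (algebraMap k[X] κ) = C (algebraMap k[X] κ h) * M := by
  classical
  let _ : NormalizedGCDMonoid k[X] := Classical.choice inferInstance
  obtain ⟨b, hb, hb2⟩ := IsLocalization.integerNormalization_spec (nonZeroDivisors k[X]) M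
  have hb0 : b ≠ 0 := nonZeroDivisors.ne_zero hb
  set q := IsLocalization.integerNormalization (nonZeroDivisors k[X]) M with hq
  have hinj := IsFractionRing.injective k[X] κ
  have hbk : algebraMap k[X] κ b ≠ 0 := by simpa using hb0
  have hsm : b • M = C (algebraMap k[X] κ b) * M := by
    rw [algebra_compatible_smul κ b M, smul_eq_C_mul]
  rw [hsm] at hb2
  have hq0 : q ≠ 0 := by
    rintro h0
    rw [h0, Polynomial.map_zero] at hb2
    have := mul_eq_zero.1 hb2.symm
    rcases this with h | h
    · exact hbk (by simpa using h)
    · exact hM.ne_zero h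
  have hc0 : q.content ≠ 0 := by rwa [Ne, content_eq_zero_iff]
  have hck : algebraMap k[X] κ q.content ≠ 0 := by simpa using hc0
  have h1 : C (algebraMap k[X] κ q.content) * q.primPart.map (algebraMap k[X] κ)
      = C (algebraMap k[X] κ b) * M := by
    rw [← hb2]
    conv_rhs => rw [eq_C_content_mul_primPart q]
    rw [Polynomial.map_mul, map_C]
  have h2 : q.primPart.map (algebraMap k[X] κ)
      = C ((algebraMap k[X] κ q.content)⁻¹ * algebraMap k[X] κ b) * M := by
    rw [C_mul, mul_assoc, ← h1, ← mul_assoc, ← C_mul, inv_mul_cancel₀ hck, C_1, one_mul]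
  have h3 : algebraMap k[X] κ q.primPart.leadingCoeff
      = (algebraMap k[X] κ q.content)⁻¹ * algebraMap k[X] κ b := by
    have := congrArg Polynomial.leadingCoeff h2
    rwa [leadingCoeff_map_of_injective hinj, leadingCoeff_mul, leadingCoeff_C, hM.leadingCoeff,
      mul_one] at this
  refine ⟨q.primPart, q.primPart.leadingCoeff, ?_, q.isPrimitive_primPart, ?_⟩
  · simpa using q.primPart_ne_zero
  · rw [h3, h2]

theorem core1 {k κ E : Type*} [Field k] [Field κ] [Field E] [Algebra k[X] κ]
    [IsFractionRing k[X] κ] [Algebra κ E] [Algebra k[X] E] [IsScalarTower k[X] κ E]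
    [FiniteDimensional κ E] [IsGalois κ E]
    (v : Valuation E (WithZero (Multiplicative ℤ))) (σ : E →+* E) (p N : ℕ) (hp : 1 ≤ p)
    (hv : ∀ P : k[X], P ≠ 0 → v (algebraMap k[X] E P) = WithZero.exp (P.natDegree : ℤ))
    (hσv : ∀ y, v (σ y) = v y)
    (hσp : ∀ y, v y ≤ 1 → v (σ y - y ^ p) ≤ WithZero.exp (-1 : ℤ))
    (hσA : ∀ P : k[X], ∃ P' : k[X], σ (algebraMap k[X] E P) = algebraMap k[X] E P')
    (hσγ : ∀ (γ : E ≃ₐ[κ] E) y, σ (γ y) = γ (σ y))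
    (M : κ[X]) (hM : M.Monic) (hMi : Irreducible M)
    (H : k[X][X]) (hH0 : H ≠ 0) (hHN : ∀ i, (H.coeff i).natDegree ≤ N)
    (hMH : M ∣ H.map (algebraMap k[X] κ))
    (G : E[X]) (hG : G.Monic) (hGM : G ∣ M.map (algebraMap κ E))
    (i₀ : ℕ) (hi₀ : σ (G.coeff i₀) ≠ (G.coeff i₀) ^ p) :
    M.natDegree ≤ N * (p + 1) * G.natDegree := by
  classical
  have hinjE : Function.Injective (algebraMap κ E) := (algebraMap κ E).injective
  have hinjA : Function.Injective (algebraMap k[X] E) := by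
    rw [IsScalarTower.algebraMap_eq k[X] κ E]
    exact hinjE.comp (IsFractionRing.injective k[X] κ)
  -- the conjugate product
  let Gg : (E ≃ₐ[κ] E) → E[X] := fun γ => G.map (γ : E →+* E)
  have hGg : ∀ γ, (Gg γ).Monic := fun γ => hG.map _
  let Q : E[X] := ∏ γ, Gg γ
  have hQm : Q.Monic := monic_prod_of_monic _ _ fun γ _ => hGg γ
  have hQfix : ∀ δ : E ≃ₐ[κ] E, Q.map (δ : E →+* E) = Q := by
    intro δ
    simp only [Q, Polynomial.map_prod]
    refine Fintype.prod_equiv (Equiv.mulLeft δ) _ _ ?_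
    intro γ
    simp only [Gg, Polynomial.map_map]
    rfl
  obtain ⟨Q0, hQ0⟩ : ∃ Q0 : κ[X], Q0.map (algebraMap κ E) = Q := by
    rw [← Polynomial.mem_lifts, Polynomial.lifts_iff_coeff_lifts]
    intro n
    rw [IsGalois.mem_range_algebraMap_iff_fixed]
    intro δ
    conv_rhs => rw [← hQfix δ]
    rw [coeff_map]
    rfl
  have hQ0m : Q0.Monic := by
    rw [← Polynomial.monic_map_iff (f := algebraMap κ E), hQ0]
    exact hQm
  set g := Fintype.card (E ≃ₐ[κ] E) with hg
  have hgpos : 0 < g := Fintype.card_pos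
  have hGgM : ∀ γ, Gg γ ∣ M.map (algebraMap κ E) := by
    intro γ
    have := Polynomial.map_dvd (γ : E →+* E) hGM
    rw [Polynomial.map_map] at this
    have h2 : (γ : E →+* E).comp (algebraMap κ E) = algebraMap κ E := by
      ext x
      simp
    rwa [h2] at this
  have hQdvd : Q0 ∣ M ^ g := by
    rw [← Polynomial.map_dvd_map' (algebraMap κ E), hQ0, Polynomial.map_pow]
    have : Q ∣ ∏ γ : E ≃ₐ[κ] E, M.map (algebraMap κ E) := Finset.prod_dvd_prod_of_dvd _ _ fun γ _ => hGgM γ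
    simpa [Finset.prod_const] using this
  obtain ⟨a, -, ha⟩ := (dvd_prime_pow hMi.prime g).1 hQdvd
  have hQM : Q0 = M ^ a := eq_of_monic_of_associated hQ0m (hM.pow a) ha
  have hdeg : a * M.natDegree = g * G.natDegree := by
    rw [← hM.natDegree_pow, ← hQM, ← natDegree_map (algebraMap κ E), hQ0]
    simp only [Q]
    rw [natDegree_prod_of_monic _ _ fun γ _ => hGg γ]
    simp [Gg, hg]
  have hQMa : Q = (M.map (algebraMap κ E)) ^ a := by
    rw [← hQ0, hQM, Polynomial.map_pow]
  -- integral primitive multiple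
  obtain ⟨Mt, h, hh0, hMt, hMth⟩ := exists_primitive_multiple (k := k) M hM
  have hMtE : Mt.map (algebraMap k[X] E) = C (algebraMap k[X] E h) * M.map (algebraMap κ E) := by
    rw [IsScalarTower.algebraMap_eq k[X] κ E, ← Polynomial.map_map, hMth, Polynomial.map_mul, map_C]
    rfl
  have hMtH : Mt ∣ H := by
    apply hMt.dvd_of_fraction_map_dvd_fraction_map (K := κ)
    rw [hMth]
    have : IsUnit (C (algebraMap k[X] κ h)) := by
      rw [isUnit_C, isUnit_iff_ne_zero]
      simpa using hh0
    exact (this.mul_left_dvd).2 hMH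
  obtain ⟨R, hR⟩ := hMtH
  have hR0 : R ≠ 0 := by
    rintro rfl
    exact hH0 (by simpa using hR)
  have hv1 : ∀ P : k[X], P ≠ 0 → 1 ≤ v (algebraMap k[X] E P) := by
    intro P hP
    rw [hv P hP, ← WithZero.exp_zero, WithZero.exp_le_exp]
    positivity
  have hgnM : v (algebraMap k[X] E h) * gn v (M.map (algebraMap κ E)) ≤ WithZero.exp (N : ℤ) := by
    rw [← gn_C, ← gn_mul, ← hMtE]
    have h1 : gn v (Mt.map (algebraMap k[X] E)) * gn v (R.map (algebraMap k[X] E)) ≤ WithZero.exp (N : ℤ) := by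
      rw [← gn_mul, ← Polynomial.map_mul, ← hR]
      apply gn_le
      intro i
      rw [coeff_map]
      by_cases hz : H.coeff i = 0
      · simp [hz]
      · rw [hv _ hz, WithZero.exp_le_exp]
        exact_mod_cast hHN i
    have h2 : 1 ≤ gn v (R.map (algebraMap k[X] E)) := by
      refine le_trans ?_ (gn_coeff_le v _ R.natDegree)
      rw [coeff_map]
      apply hv1
      simpa using hR0
    exact le_trans (le_mul_of_one_le_right' h2) h1
  set φ := G.coeff i₀ with hφ
  set ψ := σ φ - φ ^ p with hψ
  have hψ0 : ψ ≠ 0 := sub_ne_zero.2 hi₀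
  have hγψ : ∀ γ : E ≃ₐ[κ] E, γ ψ = σ (γ φ) - (γ φ) ^ p := by
    intro γ
    rw [hψ, map_sub, map_pow, hσγ]
  have hγφ : ∀ γ : E ≃ₐ[κ] E, γ φ = (Gg γ).coeff i₀ := by
    intro γ
    simp [Gg, hφ]
  set Ψ := ∏ γ : E ≃ₐ[κ] E, γ ψ with hΨ
  -- infinite place
  have hinf : v Ψ * WithZero.exp (g : ℤ) ≤ gn v (M.map (algebraMap κ E)) ^ (a * (p + 1)) := by
    have h1 : ∀ γ : E ≃ₐ[κ] E, v (γ ψ) * WithZero.exp (1:ℤ) ≤ gn v (Gg γ) ^ (p + 1) := by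
      intro γ
      have hc := one_le_gn v (Gg γ) (hGg γ)
      have hy : v (γ φ) ≤ gn v (Gg γ) := by
        rw [hγφ]; exact gn_coeff_le _ _ _
      rw [hγψ]
      rcases hc.eq_or_lt with hc1 | hc1
      · rw [← hc1] at hy ⊢
        have := hσp _ hy
        rw [one_pow]
        calc _ ≤ WithZero.exp (-1:ℤ) * WithZero.exp (1:ℤ) := mul_le_mul_left this _
          _ = 1 := by rw [← WithZero.exp_add]; simp
      · rw [pow_succ]
        refine mul_le_mul' ?_ (exp_one_le_of_one_lt _ hc1)
        apply Valuation.map_sub_le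
        · rw [hσv]
          exact hy.trans (le_self_pow hc (by omega))
        · rw [map_pow]
          exact pow_le_pow_left' hy p
    have h2 : ∏ γ : E ≃ₐ[κ] E, (v (γ ψ) * WithZero.exp (1:ℤ)) ≤ ∏ γ : E ≃ₐ[κ] E, gn v (Gg γ) ^ (p + 1) :=
      Finset.prod_le_prod' fun γ _ => h1 γ
    rw [Finset.prod_mul_distrib, Finset.prod_const, Finset.card_univ, ← map_prod, Finset.prod_pow,
      ← gn_prod] at h2
    rw [pow_mul, ← gn_pow, ← hQMa]
    rw [← WithZero.exp_nsmul] at h2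
    simpa [hg, hΨ, Q, map_prod] using h2
  -- the integral element
  obtain ⟨h', hh'⟩ := hσA h
  set Z := Ψ * (algebraMap k[X] E h) ^ (a * p) * (algebraMap k[X] E h') ^ a with hZ
  have hZint : IsIntegral k[X] Z := by
    apply isIntegral_of_forall_valuation
    intro V hV
    rw [← ValuationSubring.valuation_le_one_iff]
    set w := V.valuation with hw
    have hV' : ∀ P : k[X], w (algebraMap k[X] E P) ≤ 1 := fun P =>
      (V.valuation_le_one_iff _).2 (hV P)
    have h1 : w (algebraMap k[X] E h) * gn w (M.map (algebraMap κ E)) ≤ 1 := by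
      rw [← gn_C, ← gn_mul, ← hMtE]
      apply gn_le
      intro i
      rw [coeff_map]
      exact hV' _
    have h2 : w (algebraMap k[X] E h') * gn w ((M.map (algebraMap κ E)).map σ) ≤ 1 := by
      rw [← gn_C, ← gn_mul, ← hh', ← Polynomial.map_C, ← Polynomial.map_mul, ← hMtE]
      apply gn_le
      intro i
      rw [coeff_map, coeff_map]
      obtain ⟨P', hP'⟩ := hσA (Mt.coeff i)
      rw [hP']
      exact hV' _
    have h3 : ∀ γ : E ≃ₐ[κ] E, w (γ ψ) ≤ gn w ((Gg γ).map σ) * gn w (Gg γ) ^ p := by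
      intro γ
      have hc := one_le_gn w (Gg γ) (hGg γ)
      have hc' := one_le_gn w _ ((hGg γ).map σ)
      rw [hγψ]
      apply Valuation.map_sub_le
      · refine le_trans ?_ (le_mul_of_one_le_right' (one_le_pow_of_one_le' hc p))
        rw [hγφ, ← coeff_map]
        exact gn_coeff_le _ _ _
      · refine le_trans ?_ (le_mul_of_one_le_left' hc')
        rw [map_pow, hγφ]
        exact pow_le_pow_left' (gn_coeff_le _ _ _) p
    have h4 : w Ψ ≤ gn w ((M.map (algebraMap κ E)).map σ) ^ a * gn w (M.map (algebraMap κ E)) ^ (a * p) := by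
      rw [hΨ, map_prod, pow_mul, ← gn_pow, ← gn_pow w _ a, ← Polynomial.map_pow, ← hQMa]
      refine le_trans (Finset.prod_le_prod' fun γ _ => h3 γ) ?_
      rw [Finset.prod_mul_distrib, Finset.prod_pow, ← gn_prod, ← gn_prod, ← Polynomial.map_prod]
    rw [hZ, map_mul, map_mul, map_pow, map_pow]
    calc _ ≤ gn w ((M.map (algebraMap κ E)).map σ) ^ a * gn w (M.map (algebraMap κ E)) ^ (a * p)
        * w (algebraMap k[X] E h) ^ (a * p) * w (algebraMap k[X] E h') ^ a := by gcongr
      _ = (w (algebraMap k[X] E h') * gn w ((M.map (algebraMap κ E)).map σ)) ^ a *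
        (w (algebraMap k[X] E h) * gn w (M.map (algebraMap κ E))) ^ (a * p) := by
          rw [mul_pow, mul_pow]
          ac_rfl
      _ ≤ 1 := mul_le_one' (pow_le_one' h2 _) (pow_le_one' h1 _)
  have hZ0 : Z ≠ 0 := by
    have e1 : algebraMap k[X] E h ≠ 0 := by rwa [Ne, map_eq_zero_iff _ hinjA]
    have e2 : algebraMap k[X] E h' ≠ 0 := by
      rw [← hh']
      simpa using e1
    have e3 : Ψ ≠ 0 := Finset.prod_ne_zero_iff.2 fun γ _ => by simpa using hψ0
    exact mul_ne_zero (mul_ne_zero e3 (pow_ne_zero _ e1)) (pow_ne_zero _ e2)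
  obtain ⟨z, hz⟩ : Z ∈ Set.range (algebraMap κ E) := by
    rw [IsGalois.mem_range_algebraMap_iff_fixed]
    intro δ
    have e1 : ∀ P : k[X], δ (algebraMap k[X] E P) = algebraMap k[X] E P := by
      intro P
      rw [IsScalarTower.algebraMap_apply k[X] κ E]
      simp
    have e2 : δ Ψ = Ψ := by
      rw [hΨ, map_prod]
      exact Fintype.prod_equiv (Equiv.mulLeft δ) _ _ fun γ => rfl
    rw [hZ, map_mul, map_mul, map_pow, map_pow, e1, e1, e2]
  obtain ⟨ζ, hζ⟩ : ∃ ζ : k[X], algebraMap k[X] κ ζ = z := by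
    apply IsIntegrallyClosed.isIntegral_iff.1
    rw [← isIntegral_algebraMap_iff (B := E) hinjE, hz]
    exact hZint
  have hζZ : algebraMap k[X] E ζ = Z := by
    rw [IsScalarTower.algebraMap_apply k[X] κ E, hζ, hz]
  have hζ0 : ζ ≠ 0 := by
    rintro rfl
    exact hZ0 (by simpa using hζZ.symm)
  have hvZ : 1 ≤ v Z := by
    rw [← hζZ]; exact hv1 _ hζ0
  have hvZ2 : v Z = v Ψ * v (algebraMap k[X] E h) ^ (a * (p + 1)) := by
    rw [hZ, map_mul, map_mul, map_pow, map_pow, ← hh', hσv, mul_assoc, ← pow_add]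
    congr 2
  have hfin : WithZero.exp (g : ℤ) ≤ WithZero.exp ((N * (a * (p + 1)) : ℕ) : ℤ) := by
    calc WithZero.exp (g : ℤ) ≤ v Z * WithZero.exp (g : ℤ) := le_mul_of_one_le_left' hvZ
      _ = (v Ψ * WithZero.exp (g : ℤ)) * v (algebraMap k[X] E h) ^ (a * (p + 1)) := by
        rw [hvZ2, mul_right_comm]
      _ ≤ gn v (M.map (algebraMap κ E)) ^ (a * (p + 1)) * v (algebraMap k[X] E h) ^ (a * (p + 1)) :=
        mul_le_mul_left hinf _
      _ = (v (algebraMap k[X] E h) * gn v (M.map (algebraMap κ E))) ^ (a * (p + 1)) := by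
        rw [mul_pow, mul_comm]
      _ ≤ WithZero.exp (N : ℤ) ^ (a * (p + 1)) := pow_le_pow_left' hgnM _
      _ = _ := by
        rw [← WithZero.exp_nsmul]
        congr 1
        push_cast
        simp
        ring
  rw [WithZero.exp_le_exp] at hfin
  have hfin' : g ≤ N * (a * (p + 1)) := by exact_mod_cast hfin
  have : g * M.natDegree ≤ g * (N * (p + 1) * G.natDegree) := by
    calc g * M.natDegree ≤ N * (a * (p + 1)) * M.natDegree := Nat.mul_le_mul_right _ hfin'
      _ = N * (p + 1) * (a * M.natDegree) := by ring
      _ = _ := by rw [hdeg]; ring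
  exact Nat.le_of_mul_le_mul_left this hgpos

end core1


section qit

/-- The `n`-th iterate of `z^2 + b z`. -/
noncomputable def qit {R : Type*} [CommRing R] (b : R) : ℕ → R[X]
  | 0 => X
  | n + 1 => (qit b n) ^ 2 + C b * qit b n

/-- The polynomial whose roots are the points with `f^(I+J) = f^I`. -/
noncomputable def qF {R : Type*} [CommRing R] (b : R) (I J : ℕ) : R[X] := qit b (I + J) - qit b I

lemma qit_eval {R : Type*} [CommRing R] (b z : R) (n : ℕ) :
    (qit b n).eval z = (fun z => z ^ 2 + b * z)^[n] z := by
  induction n with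
  | zero => simp [qit]
  | succ n ih => rw [Function.iterate_succ_apply', ← ih]; simp [qit]

lemma qit_map {R S : Type*} [CommRing R] [CommRing S] (φ : R →+* S) (b : R) (n : ℕ) :
    (qit b n).map φ = qit (φ b) n := by
  induction n with
  | zero => simp [qit]
  | succ n ih => simp [qit, ih]

lemma qF_map {R S : Type*} [CommRing R] [CommRing S] (φ : R →+* S) (b : R) (I J : ℕ) :
    (qF b I J).map φ = qF (φ b) I J := by
  simp [qF, qit_map]

lemma qit_monic {R : Type*} [CommRing R] [Nontrivial R] (b : R) (n : ℕ) :
    (qit b n).Monic ∧ (qit b n).natDegree = 2 ^ n := by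
  induction n with
  | zero => simp [qit, monic_X]
  | succ n ih =>
    have h1 : ((qit b n) ^ 2).natDegree = 2 ^ (n + 1) := by
      rw [ih.1.natDegree_pow, ih.2]; ring
    have hlt : (C b * qit b n).natDegree < ((qit b n) ^ 2).natDegree := by
      rw [h1]
      refine lt_of_le_of_lt (natDegree_C_mul_le _ _) ?_
      rw [ih.2]
      exact Nat.pow_lt_pow_right (by norm_num) (by omega)
    refine ⟨?_, ?_⟩
    · exact (ih.1.pow 2).add_of_left (degree_lt_degree hlt)
    · rw [qit, natDegree_add_eq_left_of_natDegree_lt hlt, h1]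

lemma qF_monic {R : Type*} [CommRing R] [Nontrivial R] (b : R) (I J : ℕ) (hJ : 1 ≤ J) :
    (qF b I J).Monic ∧ (qF b I J).natDegree = 2 ^ (I + J) := by
  have h1 := qit_monic b (I + J)
  have h2 := qit_monic b I
  have hlt : (qit b I).natDegree < (qit b (I + J)).natDegree := by
    rw [h1.2, h2.2]
    exact Nat.pow_lt_pow_right (by norm_num) (by omega)
  refine ⟨?_, ?_⟩
  · exact h1.1.sub_of_left (degree_lt_degree hlt)
  · rw [qF, natDegree_sub_eq_left_of_natDegree_lt hlt, h1.2]

end qit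

section fixedpoint
variable {R : Type*} [CommRing R] {A : Type*}
open PowerSeries in
lemma ps_fixed_unique (Φ : (A → PowerSeries R) → (A → PowerSeries R))
    (hΦ : ∀ n y y', (∀ s, (PowerSeries.X : PowerSeries R) ^ n ∣ y s - y' s) →
      ∀ s, (PowerSeries.X : PowerSeries R) ^ (n + 1) ∣ Φ y s - Φ y' s)
    (y y' : A → PowerSeries R) (h : Φ y = y) (h' : Φ y' = y') : y = y' := by
  have h1 : ∀ n, ∀ s, (PowerSeries.X : PowerSeries R) ^ n ∣ y s - y' s := by
    intro n
    induction n with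
    | zero => intro s; simp
    | succ n ih =>
      have := hΦ n y y' ih
      rwa [h, h'] at this
  funext s
  rw [← sub_eq_zero]
  ext n
  exact (PowerSeries.X_pow_dvd_iff.1 (h1 (n + 1) s)) n (by omega)

lemma ps_fixed_exists (Φ : (A → PowerSeries R) → (A → PowerSeries R))
    (hΦ : ∀ n y y', (∀ s, (PowerSeries.X : PowerSeries R) ^ n ∣ y s - y' s) →
      ∀ s, (PowerSeries.X : PowerSeries R) ^ (n + 1) ∣ Φ y s - Φ y' s) :
    ∃ y, Φ y = y := by
  let u : ℕ → A → PowerSeries R := fun n => Φ^[n] (fun _ => 0)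
  have hu : ∀ n, u (n + 1) = Φ (u n) := fun n => Function.iterate_succ_apply' _ _ _
  have h1 : ∀ n s, (PowerSeries.X : PowerSeries R) ^ n ∣ u (n + 1) s - u n s := by
    intro n
    induction n with
    | zero => intro s; simp
    | succ n ih =>
      intro s
      rw [hu (n + 1), hu n]
      have := hΦ n _ _ ih s
      rwa [hu n] at this
  have h2 : ∀ n m s, (PowerSeries.X : PowerSeries R) ^ n ∣ u (n + m) s - u n s := by
    intro n m s
    induction m with
    | zero => simp
    | succ m ih =>
      have h3 := h1 (n + m) s
      have h4 := dvd_add (dvd_trans (pow_dvd_pow _ (by omega : n ≤ n + m)) h3) ih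
      simpa [add_assoc] using h4
  let y : A → PowerSeries R := fun s => PowerSeries.mk fun n => PowerSeries.coeff n (u (n + 1) s)
  have h5 : ∀ n s, (PowerSeries.X : PowerSeries R) ^ n ∣ y s - u n s := by
    intro n s
    rw [PowerSeries.X_pow_dvd_iff]
    intro m hm
    have := (PowerSeries.X_pow_dvd_iff.1 (h2 (m + 1) (n - (m + 1)) s)) m (by omega)
    rw [show m + 1 + (n - (m + 1)) = n by omega] at this
    rw [map_sub, sub_eq_zero] at this ⊢
    simp only [y, PowerSeries.coeff_mk]
    exact this.symm
  refine ⟨y, ?_⟩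
  funext s
  rw [← sub_eq_zero]
  ext n
  have h6 := hΦ n _ _ (h5 n) s
  rw [← hu] at h6
  have h7 := dvd_sub h6 (h5 (n + 1) s)
  rw [sub_sub_sub_cancel_right] at h7
  exact (PowerSeries.X_pow_dvd_iff.1 h7) n (by omega)

/-- The coding map. -/
noncomputable def codePhi (R : Type*) [CommRing R] (y : (ℕ → Bool) → PowerSeries R) :
    (ℕ → Bool) → PowerSeries R := fun s =>
  (if s 0 then 1 else -1) * ((if s 1 then 1 else 0) - PowerSeries.X * y (fun n => s (n + 1)) +
    PowerSeries.X * y s ^ 2)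

lemma codePhi_contr (n : ℕ) (y y' : (ℕ → Bool) → PowerSeries R)
    (h : ∀ s, (PowerSeries.X : PowerSeries R) ^ n ∣ y s - y' s) (s : ℕ → Bool) :
    (PowerSeries.X : PowerSeries R) ^ (n + 1) ∣ codePhi R y s - codePhi R y' s := by
  have e : codePhi R y s - codePhi R y' s = (if s 0 then 1 else -1) *
      (PowerSeries.X * ((y s - y' s) * (y s + y' s) - (y (fun n => s (n + 1)) - y' (fun n => s (n + 1))))) := by
    simp only [codePhi]; ring
  rw [e, pow_succ']
  apply Dvd.dvd.mul_left
  apply mul_dvd_mul_left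
  exact dvd_sub (Dvd.dvd.mul_right (h _) _) (h _)

lemma code_exists (R : Type*) [CommRing R] : ∃ y : (ℕ → Bool) → PowerSeries R, codePhi R y = y ∧
    ∀ (τ : R →+* R) s, PowerSeries.map τ (y s) = y s := by
  obtain ⟨y, hy⟩ := ps_fixed_exists (codePhi R) codePhi_contr
  refine ⟨y, hy, ?_⟩
  intro τ s
  have := ps_fixed_unique (codePhi R) codePhi_contr (fun s => PowerSeries.map τ (y s)) y ?_ hy
  · exact congrFun this s
  · funext s
    conv_rhs => rw [← hy]
    simp only [codePhi, map_mul, map_add, map_sub, map_pow, PowerSeries.map_X]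
    congr 1
    · split_ifs <;> simp
    · congr 2
      split_ifs <;> simp
end fixedpoint


section laurent
universe u

lemma laurent_exists (k : Type u) [Field k] (p : ℕ) [hpp : Fact p.Prime] [CharP k p] :
    ∃ (Λ : Type u) (_ : Field Λ) (v : Valuation Λ (WithZero (Multiplicative ℤ)))
      (j : RatFunc k →+* Λ) (σ : Λ →+* Λ) (z : (ℕ → Bool) → Λ),
      (∀ P : k[X], P ≠ 0 → v (j (algebraMap k[X] (RatFunc k) P)) = WithZero.exp (P.natDegree : ℤ)) ∧
      (∀ y, v (σ y) = v y) ∧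
      (∀ y, v y ≤ 1 → v (σ y - y ^ p) ≤ WithZero.exp (-1 : ℤ)) ∧
      (∀ y, σ y = y ^ p → ∃ c : k, y = j (algebraMap k[X] (RatFunc k) (C c))) ∧
      (∀ P : k[X], ∃ P' : k[X], σ (j (algebraMap k[X] (RatFunc k) P)) =
        j (algebraMap k[X] (RatFunc k) P')) ∧
      (∀ s, z s ^ 2 + j RatFunc.X * z s = z (fun n => s (n + 1))) ∧
      (∀ s, if s 0 then v (z s + j RatFunc.X) ≤ 1 else v (z s) ≤ 1) ∧
      (∀ s, σ (z s) = z s) := by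
  have hp2 : 2 ≤ p := hpp.out.two_le
  have : ExpChar k p := ExpChar.prime hpp.out
  let Λ := LaurentSeries k
  have : CharP Λ p := charP_of_injective_ringHom (HahnSeries.C : k →+* Λ).injective p
  have : ExpChar Λ p := ExpChar.prime hpp.out
  let v : Valuation Λ (WithZero (Multiplicative ℤ)) := Valued.v
  let ι : PowerSeries k →+* Λ := algebraMap (PowerSeries k) Λ
  have hι : ∀ y : Λ, v y ≤ 1 ↔ ∃ F, ι F = y := fun y => LaurentSeries.val_le_one_iff_eq_coe k y
  let c : k →+* Λ := ι.comp (PowerSeries.C)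
  let x : Λ := ι PowerSeries.X
  have hvx : v x = WithZero.exp (-1 : ℤ) := by
    have := LaurentSeries.valuation_X_pow k 1
    rw [pow_one] at this
    exact this
  have hx0 : x ≠ 0 := by
    intro h
    rw [h, map_zero] at hvx
    exact WithZero.exp_ne_zero hvx.symm
  have hvc1 : ∀ a, v (c a) ≤ 1 := fun a => (hι _).2 ⟨_, rfl⟩
  have hvc : ∀ a, a ≠ 0 → v (c a) = 1 := by
    intro a ha
    apply le_antisymm (hvc1 a)
    have h1 : v (c a) * v (c a⁻¹) = 1 := by
      rw [← map_mul, ← map_mul, mul_inv_cancel₀ ha, map_one, map_one]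
    calc 1 = v (c a) * v (c a⁻¹) := h1.symm
      _ ≤ v (c a) := mul_le_of_le_one_right' (hvc1 _)
  -- decomposition
  have hdec : ∀ y, v y ≤ 1 → ∃ a : k, v (y - c a) ≤ WithZero.exp (-1 : ℤ) := by
    intro y hy
    obtain ⟨F, rfl⟩ := (hι y).1 hy
    obtain ⟨G, hG⟩ : PowerSeries.X ∣ F - PowerSeries.C (PowerSeries.constantCoeff F) := by
      rw [PowerSeries.X_dvd_iff]
      simp
    refine ⟨PowerSeries.constantCoeff F, ?_⟩
    have : ι F - c (PowerSeries.constantCoeff F) = x * ι G := by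
      simp only [c, x, RingHom.comp_apply]
      rw [← map_sub, hG, map_mul]
    rw [this, map_mul, hvx]
    exact mul_le_of_le_one_right' ((hι _).2 ⟨_, rfl⟩)
  -- Frobenius
  have hinj : Function.Injective (PowerSeries.map (frobenius k p)) := by
    intro f g h
    ext n
    have := congrArg (PowerSeries.coeff n) h
    simp only [PowerSeries.coeff_map] at this
    exact (frobenius k p).injective this
  let σ : Λ →+* Λ := IsFractionRing.map (A := PowerSeries k) (B := PowerSeries k) hinj
  have hσι : ∀ F, σ (ι F) = ι (PowerSeries.map (frobenius k p) F) := fun F =>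
    IsLocalization.map_eq _ F
  have hσc : ∀ a, σ (c a) = c a ^ p := by
    intro a
    simp only [c, RingHom.comp_apply, hσι, PowerSeries.map_C]
    rw [← map_pow, ← map_pow]
    rfl
  have hσx : σ x = x := by
    simp only [x, hσι, PowerSeries.map_X]
  have hσ1 : ∀ y, v y ≤ 1 → v (σ y) ≤ 1 := by
    intro y hy
    obtain ⟨F, rfl⟩ := (hι y).1 hy
    rw [hσι]
    exact (hι _).2 ⟨_, rfl⟩
  have hσu : ∀ y, v y = 1 → v (σ y) = 1 := by
    intro y hy
    have hy0 : y ≠ 0 := by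
      rintro rfl
      simp at hy
    apply le_antisymm (hσ1 y hy.le)
    have h1 : v (σ y) * v (σ y⁻¹) = 1 := by
      rw [← map_mul, ← map_mul, mul_inv_cancel₀ hy0, map_one, map_one]
    calc 1 = v (σ y) * v (σ y⁻¹) := h1.symm
      _ ≤ v (σ y) := mul_le_of_le_one_right' (hσ1 _ (by rw [map_inv₀, hy, inv_one]))
  have hσv : ∀ y, v (σ y) = v y := by
    intro y
    by_cases hy : y = 0
    · simp [hy]
    obtain ⟨n, hn⟩ : ∃ n : ℤ, v y = WithZero.exp n :=
      ⟨_, (WithZero.exp_log ((Valuation.ne_zero_iff v).2 hy)).symm⟩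
    have h2 : v (y * x ^ n) = 1 := by
      rw [map_mul, map_zpow₀, hvx, hn, ← WithZero.exp_zsmul, ← WithZero.exp_add]
      simp
    have h3 := hσu _ h2
    rw [map_mul, map_zpow₀, hσx, map_mul] at h3
    rw [map_mul] at h2
    have h4 : v (x ^ n) ≠ 0 := (Valuation.ne_zero_iff v).2 (zpow_ne_zero _ hx0)
    exact mul_right_cancel₀ h4 (h3.trans h2.symm)
  have hpow : ∀ y : Λ, ∀ a, σ y - y ^ p = σ (y - c a) - (y - c a) ^ p := by
    intro y a
    rw [sub_pow_char, map_sub, hσc]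
    ring
  -- the parameter
  let b : Λ := x⁻¹
  have hvb : v b = WithZero.exp (1 : ℤ) := by
    simp only [b, map_inv₀, hvx]
    rw [← WithZero.exp_neg]
    simp
  let _ : Algebra k Λ := c.toAlgebra
  have htriv : v.IsTrivialOn k := ⟨fun a ha => hvc a ha⟩
  have hvP : ∀ P : k[X], P ≠ 0 → v (eval₂ c b P) = WithZero.exp (P.natDegree : ℤ) := by
    intro P hP
    have := Polynomial.valuation_aeval_eq_valuation_X_pow_natDegree_of_one_lt_valuation_X
      (A := k) (v := v) b (by rw [hvb, ← WithZero.exp_zero, WithZero.exp_lt_exp]; norm_num) hP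
    rw [hvb, ← WithZero.exp_nsmul] at this
    rw [aeval_def] at this
    refine this.trans ?_
    simp
  have hj : Function.Injective (eval₂RingHom c b) := by
    rw [injective_iff_map_eq_zero]
    intro P hP
    by_contra h0
    have := hvP P h0
    rw [← coe_eval₂RingHom, hP, map_zero] at this
    exact WithZero.exp_ne_zero this.symm
  let j : RatFunc k →+* Λ := IsFractionRing.lift hj
  have hjP : ∀ P : k[X], j (algebraMap k[X] (RatFunc k) P) = eval₂ c b P := fun P =>
    IsFractionRing.lift_algebraMap hj P
  have hjX : j RatFunc.X = b := by
    rw [← RatFunc.algebraMap_X, hjP, eval₂_X]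
  obtain ⟨y, hy1, hy2⟩ := code_exists k
  let z : (ℕ → Bool) → Λ := fun s => (if s 0 then -b else 0) + ι (y s)
  refine ⟨Λ, inferInstance, v, j, σ, z, ?_, hσv, ?_, ?_, ?_, ?_, ?_, ?_⟩
  · intro P hP
    rw [hjP, hvP P hP]
  · intro y hy
    obtain ⟨a, ha⟩ := hdec y hy
    rw [hpow y a]
    apply Valuation.map_sub_le
    · rwa [hσv]
    · rw [map_pow]
      refine le_trans (pow_le_of_le_one zero_le ?_ (by omega)) ha
      refine ha.trans ?_
      rw [← WithZero.exp_zero, WithZero.exp_le_exp]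
      norm_num
  · intro y hy
    have hvy : v y ≤ 1 := by
      by_contra! h
      have h1 : v y = v y ^ p := by rw [← map_pow, ← hy, hσv]
      exact (lt_self_pow₀ h (by omega)).ne h1
    obtain ⟨a, ha⟩ := hdec y hvy
    refine ⟨a, ?_⟩
    rw [hjP, eval₂_C]
    have h2 := hpow y a
    rw [hy, sub_self, eq_comm, sub_eq_zero] at h2
    by_contra hne
    have hne' : y - c a ≠ 0 := sub_ne_zero.2 hne
    have h3 : v (y - c a) = v (y - c a) ^ p := by rw [← map_pow, ← h2, hσv]
    have h4 : v (y - c a) < 1 := by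
      refine ha.trans_lt ?_
      rw [← WithZero.exp_zero, WithZero.exp_lt_exp]
      norm_num
    exact (pow_lt_self_of_lt_one₀ (zero_lt_iff.2 ((Valuation.ne_zero_iff v).2 hne')) h4 (by omega)).ne h3.symm
  · intro P
    refine ⟨P.map (frobenius k p), ?_⟩
    rw [hjP, hjP, hom_eval₂, eval₂_map]
    have : σ b = b := by simp only [b, map_inv₀, hσx]
    rw [this]
    congr 1
    ext a
    simp only [RingHom.comp_apply, hσc, frobenius_def, map_pow]
  · intro s
    have h1 := congrFun hy1 s
    have hbx : b * x = 1 := inv_mul_cancel₀ hx0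
    have h2 : ι (y s) = (if s 0 then 1 else -1) * ((if s 1 then 1 else 0) - x * ι (y (fun n => s (n + 1))) +
        x * ι (y s) ^ 2) := by
      conv_lhs => rw [← h1]
      simp only [codePhi, map_mul, map_add, map_sub, map_pow]
      congr 1
      · split_ifs <;> simp
      · congr 2
        split_ifs <;> simp
    rw [hjX]
    simp only [z]
    simp only [zero_add]
    set A := ι (y s)
    set B := ι (y (fun n => s (n + 1)))
    cases h0 : s 0
    · cases h3 : s 1 <;> simp [h0, h3] at h2 ⊢ <;>
        linear_combination b * h2 - (A ^ 2 - B) * hbx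
    · cases h3 : s 1 <;> simp [h0, h3] at h2 ⊢ <;>
        linear_combination -b * h2 - (A ^ 2 - B) * hbx
  · intro s
    rw [hjX]
    simp only [z]
    split_ifs with h
    · have : -b + ι (y s) + b = ι (y s) := by ring
      rw [this]
      exact (hι _).2 ⟨_, rfl⟩
    · rw [zero_add]
      exact (hι _).2 ⟨_, rfl⟩
  · intro s
    have : σ b = b := by simp only [b, map_inv₀, hσx]
    simp only [z, map_add, hσι, hy2]
    congr 1
    split_ifs
    · rw [map_neg, this]
    · rw [map_zero]

end laurent


section galois
universe u

/-- Extend a word to an eventually periodic sequence. -/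
def extWord (I J : ℕ) (hJ : 1 ≤ J) (s : Fin (I + J) → Bool) (n : ℕ) : Bool :=
  if h : n < I + J then s ⟨n, h⟩ else s ⟨I + (n - I) % J, by
    have := Nat.mod_lt (n - I) (by omega : J > 0); omega⟩

lemma extWord_per (I J : ℕ) (hJ : 1 ≤ J) (s : Fin (I + J) → Bool) (n : ℕ) :
    extWord I J hJ s (n + (I + J)) = extWord I J hJ s (n + I) := by
  unfold extWord
  rw [dif_neg (by omega)]
  have e : n + (I + J) - I = n + J := by omega
  by_cases h : n + I < I + J
  · rw [dif_pos h]
    congr 1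
    ext
    simp only [e, Nat.add_mod_right]
    rw [Nat.mod_eq_of_lt (by omega)]
    omega
  · rw [dif_neg h]
    congr 1
    ext
    simp only [e, Nat.add_mod_right, Nat.add_sub_cancel]

lemma extWord_inj (I J : ℕ) (hJ : 1 ≤ J) : Function.Injective (extWord I J hJ) := by
  intro s t h
  funext i
  have := congrFun h i.1
  unfold extWord at this
  rwa [dif_pos i.2, dif_pos i.2] at this

lemma code_roots {Λ : Type*} [Field Λ] (v : Valuation Λ (WithZero (Multiplicative ℤ))) (b : Λ)
    (hb : 1 < v b) (z : (ℕ → Bool) → Λ)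
    (hz : ∀ s, z s ^ 2 + b * z s = z (fun n => s (n + 1)))
    (hz1 : ∀ s, if s 0 then v (z s + b) ≤ 1 else v (z s) ≤ 1)
    (I J : ℕ) (hJ : 1 ≤ J) :
    (qF b I J).Splits ∧ (qF b I J).Separable ∧ ∀ x, (qF b I J).IsRoot x → ∃ s, z s = x := by
  classical
  have hit : ∀ m s, (fun w => w ^ 2 + b * w)^[m] (z s) = z (fun n => s (n + m)) := by
    intro m
    induction m with
    | zero => intro s; rfl
    | succ m ih =>
      intro s
      rw [Function.iterate_succ_apply]
      simp only [hz]
      rw [ih]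
      simp only [add_assoc]
  have h0 : ∀ s t, z s = z t → s 0 = t 0 := by
    have key : ∀ s t, z s = z t → s 0 = true → t 0 = false → False := by
      intro s t h h1 h2
      have h3 := hz1 s
      have h4 := hz1 t
      rw [h1, if_pos rfl] at h3
      rw [h2] at h4
      simp only [Bool.false_eq_true, if_false] at h4
      rw [h] at h3
      have h5 : v (z t + b - z t) ≤ 1 := Valuation.map_sub_le v h3 h4
      rw [add_sub_cancel_left] at h5
      exact absurd h5 (not_le.2 hb)
    intro s t h
    cases h1 : s 0 <;> cases h2 : t 0
    · rfl
    · exact (key t s h.symm h2 h1).elim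
    · exact (key s t h h1 h2).elim
    · rfl
  have hzinj : Function.Injective z := by
    intro s t h
    funext n
    have h1 := hit n s
    rw [h, hit n t] at h1
    have := h0 _ _ h1
    simpa using this.symm
  have hmon := qF_monic b I J hJ
  have hF0 : qF b I J ≠ 0 := hmon.1.ne_zero
  let S : Finset Λ := Finset.univ.image fun s : Fin (I + J) → Bool => z (extWord I J hJ s)
  have hScard : S.card = 2 ^ (I + J) := by
    have e := Finset.card_image_of_injective (Finset.univ : Finset (Fin (I + J) → Bool))
      (hzinj.comp (extWord_inj I J hJ))
    refine Eq.trans e ?_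
    simp
  have hSsub : S ⊆ (qF b I J).roots.toFinset := by
    intro x hx
    obtain ⟨s, -, rfl⟩ := Finset.mem_image.1 hx
    rw [Multiset.mem_toFinset, mem_roots hF0]
    simp only [IsRoot, qF, eval_sub, qit_eval, hit, extWord_per, sub_self]
  have c1 := Finset.card_le_card hSsub
  have c2 := Multiset.toFinset_card_le (qF b I J).roots
  have c3 := card_roots' (qF b I J)
  rw [hmon.2] at c3
  rw [hScard] at c1
  have hsp : (qF b I J).Splits := by
    rw [splits_iff_card_roots, hmon.2]; omega
  refine ⟨hsp, ?_, ?_⟩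
  · rw [← nodup_roots_iff_of_splits hF0 hsp, ← Multiset.toFinset_card_eq_card_iff_nodup]
    omega
  · intro x hx
    have hS : S = (qF b I J).roots.toFinset := Finset.eq_of_subset_of_card_le hSsub (by omega)
    have : x ∈ S := by
      rw [hS, Multiset.mem_toFinset, mem_roots hF0]
      exact hx
    obtain ⟨s, -, rfl⟩ := Finset.mem_image.1 this
    exact ⟨_, rfl⟩

theorem galois_exists (k : Type u) [Field k] (p : ℕ) [Fact p.Prime] [CharP k p]
    (I J : ℕ) (hJ : 1 ≤ J) :
    ∃ (E : Type u) (_ : Field E) (_ : Algebra (RatFunc k) E)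
      (v : Valuation E (WithZero (Multiplicative ℤ))) (σ : E →+* E),
      IsSplittingField (RatFunc k) E (qF (RatFunc.X : RatFunc k) I J) ∧
      (qF (RatFunc.X : RatFunc k) I J).Separable ∧
      (∀ P : k[X], P ≠ 0 → v (algebraMap (RatFunc k) E (algebraMap k[X] (RatFunc k) P)) =
        WithZero.exp (P.natDegree : ℤ)) ∧
      (∀ y, v (σ y) = v y) ∧
      (∀ y, v y ≤ 1 → v (σ y - y ^ p) ≤ WithZero.exp (-1 : ℤ)) ∧
      (∀ y, σ y = y ^ p → ∃ c : k, y =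
        algebraMap (RatFunc k) E (algebraMap k[X] (RatFunc k) (C c))) ∧
      (∀ P : k[X], ∃ P' : k[X], σ (algebraMap (RatFunc k) E (algebraMap k[X] (RatFunc k) P)) =
        algebraMap (RatFunc k) E (algebraMap k[X] (RatFunc k) P')) ∧
      (∀ (γ : E ≃ₐ[RatFunc k] E) y, σ (γ y) = γ (σ y)) ∧
      (∀ x : E, ((qF (RatFunc.X : RatFunc k) I J).map (algebraMap (RatFunc k) E)).IsRoot x →
        v x ≤ 1 ∨ v (x + algebraMap (RatFunc k) E RatFunc.X) ≤ 1) := by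
  obtain ⟨Λ, _, v, j, σ, z, h1, h2, h3, h4, h5, h6, h7, h8⟩ := laurent_exists k p
  let _ : Algebra (RatFunc k) Λ := j.toAlgebra
  set F := qF (RatFunc.X : RatFunc k) I J with hF
  have hjalg : ∀ y, algebraMap (RatFunc k) Λ y = j y := fun _ => rfl
  have hFmap : F.map (algebraMap (RatFunc k) Λ) = qF (j RatFunc.X) I J := by
    rw [hF, qF_map, hjalg]
  have hb : 1 < v (j RatFunc.X) := by
    have := h1 X X_ne_zero
    rw [RatFunc.algebraMap_X, natDegree_X] at this
    rw [this, ← WithZero.exp_zero, WithZero.exp_lt_exp]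
    norm_num
  obtain ⟨r1, r2, r3⟩ := code_roots v (j RatFunc.X) hb z h6 h7 I J hJ
  rw [← hFmap] at r1 r2 r3
  have hF0 : F ≠ 0 := (qF_monic _ I J hJ).1.ne_zero
  have hsep : F.Separable := (separable_map _).1 r2
  let i : F.SplittingField →ₐ[RatFunc k] Λ := SplittingField.lift F r1
  have hinj : Function.Injective i := i.toRingHom.injective
  have hialg : ∀ y, i (algebraMap _ _ y) = j y := fun y => i.commutes y
  have hroot : ∀ x : F.SplittingField, (F.map (algebraMap (RatFunc k) _)).IsRoot x → ∃ s, z s = i x := by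
    intro x hx
    apply r3
    rw [IsRoot, eval_map_algebraMap] at hx ⊢
    rw [aeval_algHom_apply, hx, map_zero]
  have hσκ : ∀ y : RatFunc k, ∃ y', σ (j y) = j y' := by
    intro y
    obtain ⟨a, c, -, rfl⟩ := IsFractionRing.div_surjective k[X] y
    obtain ⟨a', ha⟩ := h5 a
    obtain ⟨c', hc⟩ := h5 c
    exact ⟨algebraMap _ _ a' / algebraMap _ _ c', by rw [map_div₀, map_div₀, ha, hc, map_div₀]⟩
  have hind : ∀ (Pr : F.SplittingField → Prop), (∀ x, (F.map (algebraMap (RatFunc k) _)).IsRoot x → Pr x) →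
      (∀ y, Pr (algebraMap (RatFunc k) _ y)) → (∀ x y, Pr x → Pr y → Pr (x + y)) →
      (∀ x y, Pr x → Pr y → Pr (x * y)) → ∀ x, Pr x := by
    intro Pr e1 e2 e3 e4 x
    have hx : x ∈ Algebra.adjoin (RatFunc k) (F.rootSet F.SplittingField) := by
      rw [SplittingField.adjoin_rootSet]; trivial
    refine Algebra.adjoin_induction (p := fun x _ => Pr x) ?_ e2 (fun x y _ _ => e3 x y)
      (fun x y _ _ => e4 x y) hx
    intro x hx
    apply e1
    rw [IsRoot, eval_map_algebraMap]
    exact (mem_rootSet.1 hx).2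
  have hrange : ∀ y, ∃ y', i y' = σ (i y) := by
    apply hind
    · intro x hx
      obtain ⟨s, hs⟩ := hroot x hx
      exact ⟨x, by rw [← hs, h8]⟩
    · intro y
      obtain ⟨y', hy'⟩ := hσκ y
      exact ⟨algebraMap _ _ y', by rw [hialg, hialg, hy']⟩
    · rintro x y ⟨x', hx⟩ ⟨y', hy⟩
      exact ⟨x' + y', by rw [map_add, hx, hy, map_add, map_add]⟩
    · rintro x y ⟨x', hx⟩ ⟨y', hy⟩
      exact ⟨x' * y', by rw [map_mul, hx, hy, map_mul, map_mul]⟩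
  choose σE hσE using hrange
  let σ' : F.SplittingField →+* F.SplittingField :=
    { toFun := σE
      map_one' := hinj (by rw [hσE, map_one, map_one])
      map_mul' := fun x y => hinj (by rw [hσE, map_mul, map_mul, map_mul, hσE, hσE])
      map_zero' := hinj (by rw [hσE, map_zero, map_zero])
      map_add' := fun x y => hinj (by rw [hσE, map_add, map_add, map_add, hσE, hσE]) }
  have hσ' : ∀ y, i (σ' y) = σ (i y) := hσE
  refine ⟨F.SplittingField, inferInstance, inferInstance, v.comap i.toRingHom, σ', inferInstance, hsep,
    ?_, ?_, ?_, ?_, ?_, ?_, ?_⟩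
  · intro P hP
    rw [Valuation.comap_apply]
    exact (congrArg v (hialg _)).trans (h1 P hP)
  · intro y
    exact (congrArg v (hσ' y)).trans (h2 _)
  · intro y hy
    have := h3 (i y) hy
    rw [← hσ', ← map_pow, ← map_sub] at this
    exact this
  · intro y hy
    have := h4 (i y) (by rw [← hσ', hy, map_pow])
    obtain ⟨c, hc⟩ := this
    refine ⟨c, hinj ?_⟩
    rw [hialg, hc]
  · intro P
    obtain ⟨P', hP'⟩ := h5 P
    exact ⟨P', hinj (by rw [hσ', hialg, hialg, hP'])⟩
  · intro γ
    have hfix : ∀ x : F.SplittingField, (F.map (algebraMap (RatFunc k) _)).IsRoot x → σ' x = x := by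
      intro x hx
      obtain ⟨s, hs⟩ := hroot x hx
      apply hinj
      rw [hσ', ← hs, h8]
    apply hind
    · intro x hx
      rw [hfix x hx, hfix]
      rw [IsRoot, eval_map_algebraMap] at hx ⊢
      have := aeval_algHom_apply γ.toAlgHom x F
      rw [hx, map_zero] at this
      exact this
    · intro y
      obtain ⟨y', hy'⟩ := hσκ y
      have : σ' (algebraMap _ _ y) = algebraMap _ _ y' := hinj (by rw [hσ', hialg, hialg, hy'])
      rw [AlgEquiv.commutes, this, AlgEquiv.commutes]
    · intro x y hx hy
      simp only [map_add, hx, hy]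
    · intro x y hx hy
      simp only [map_mul, hx, hy]
  · intro x hx
    obtain ⟨s, hs⟩ := hroot x hx
    have e1 : (v.comap i.toRingHom) x = v (z s) := by rw [hs]; rfl
    have e2 : (v.comap i.toRingHom) (x + algebraMap (RatFunc k) _ RatFunc.X) = v (z s + j RatFunc.X) := by
      rw [hs, ← hialg, ← map_add]
      rfl
    rw [e1, e2]
    have := h7 s
    split_ifs at this
    · exact Or.inr this
    · exact Or.inl this

end galois


section core3

lemma finrank_span_le_of_dep {A V : Type*} [Field A] [AddCommGroup V] [Module A V] (s : Set V) (N : ℕ)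
    (h : ∀ y : Fin (N + 1) → V, (∀ i, y i ∈ s) → ¬ LinearIndependent A y) :
    Module.finrank A (Submodule.span A s) ≤ N := by
  classical
  obtain ⟨b, hbs, hspan, hli⟩ := exists_linearIndependent A s
  rw [← hspan]
  have hcard : ∀ t : Finset V, (t : Set V) ⊆ b → t.card ≤ N := by
    intro t ht
    by_contra! hc
    obtain ⟨t', ht', hc'⟩ := Finset.exists_subset_card_eq (show N + 1 ≤ t.card by omega)
    let e := t'.equivFinOfCardEq hc'
    apply h (fun i => (e.symm i : V)) (fun i => hbs (ht (ht' (e.symm i).2)))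
    have := hli.comp (fun i : Fin (N + 1) => (⟨(e.symm i : V), ht (ht' (e.symm i).2)⟩ : b)) (by
      intro i j hij
      simp only [Subtype.mk.injEq] at hij
      exact e.symm.injective (Subtype.ext hij))
    exact this
  have hfin : b.Finite := by
    by_contra hinf
    obtain ⟨t, ht, hc⟩ := (Set.Infinite.exists_subset_card_eq (s := b) hinf (N + 1))
    have := hcard t ht
    omega
  have := hfin.fintype
  rw [finrank_span_set_eq_card hli]
  have h2 := hcard b.toFinset (by simp)
  exact h2

theorem core3 {k κ E : Type*} [Field k] [Field κ] [Field E] [Algebra k[X] κ]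
    [IsFractionRing k[X] κ] [Algebra κ E] [Algebra k[X] E] [IsScalarTower k[X] κ E]
    [FiniteDimensional κ E] [IsGalois κ E]
    (v : Valuation E (WithZero (Multiplicative ℤ)))
    (hv : ∀ P : k[X], P ≠ 0 → v (algebraMap k[X] E P) = WithZero.exp (P.natDegree : ℤ))
    (R : Set E) (hRγ : ∀ (γ : E ≃ₐ[κ] E), ∀ x ∈ R, γ x ∈ R)
    (hRf : ∀ x ∈ R, x ^ 2 + algebraMap k[X] E X * x ∈ R)
    (hRi : ∀ x ∈ R, IsIntegral k[X] x)
    (hRv : ∀ x ∈ R, v x ≤ 1 ∨ v (x + algebraMap k[X] E X) ≤ 1)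
    (P : Finset E) (hP : ∀ x ∈ P, x ∈ R) :
    P.card ≤ 4 ^ Module.finrank κ (IntermediateField.adjoin κ (P : Set E)) := by
  classical
  set b := algebraMap k[X] E X with hb
  have hvb : v b = WithZero.exp (1 : ℤ) := by
    have := hv X X_ne_zero
    rwa [natDegree_X] at this
  have hb1 : 1 < v b := by
    rw [hvb, ← WithZero.exp_zero, WithZero.exp_lt_exp]; norm_num
  set L0 := IntermediateField.adjoin κ (P : Set E) with hL0
  have hxL : ∀ x : P, (x : E) ∈ L0 := fun x => IntermediateField.subset_adjoin κ _ x.2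
  -- code
  let code : P → (L0 →ₐ[κ] E) → Bool × Bool := fun x η =>
    (decide (v (η ⟨x, hxL x⟩) ≤ 1), decide (v ((η ⟨x, hxL x⟩) ^ 2 + b * η ⟨x, hxL x⟩) ≤ 1))
  have hcl : ∀ u ∈ R, ∀ w ∈ R, (v u ≤ 1 ↔ v w ≤ 1) → v (u - w) ≤ 1 ∧ v (u + w + b) = v b := by
    intro u hu w hw huw
    by_cases h1 : v u ≤ 1
    · have h2 := huw.1 h1
      refine ⟨v.map_sub_le h1 h2, ?_⟩
      rw [Valuation.map_add_eq_of_lt_right]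
      exact lt_of_le_of_lt (v.map_add_le h1 h2) hb1
    · have h2 : ¬ v w ≤ 1 := fun h => h1 (huw.2 h)
      have h3 := (hRv u hu).resolve_left h1
      have h4 := (hRv w hw).resolve_left h2
      refine ⟨?_, ?_⟩
      · have := v.map_sub_le h3 h4
        rwa [add_sub_add_right_eq_sub] at this
      · have : u + w + b = (u + b) + (w + b) + -b := by ring
        rw [this, Valuation.map_add_eq_of_lt_right, Valuation.map_neg]
        rw [Valuation.map_neg]
        exact lt_of_le_of_lt (v.map_add_le h3 h4) hb1
  have hinj : Function.Injective code := by
    intro x y hxy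
    by_contra hne
    have hc : (x : E) - y ≠ 0 := sub_ne_zero.2 fun h => hne (Subtype.ext h)
    set c := (x : E) - y with hcdef
    have hγ : ∀ γ : E ≃ₐ[κ] E, v (γ c) ≤ WithZero.exp (-1 : ℤ) := by
      intro γ
      have h1 := congrFun hxy (γ.toAlgHom.comp L0.val)
      simp only [code, Prod.mk.injEq, decide_eq_decide] at h1
      have hu := hRγ γ x (hP _ x.2)
      have hw := hRγ γ y (hP _ y.2)
      have e1 : (γ.toAlgHom.comp L0.val) ⟨x, hxL x⟩ = γ x := rfl
      have e2 : (γ.toAlgHom.comp L0.val) ⟨y, hxL y⟩ = γ y := rfl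
      rw [e1, e2] at h1
      obtain ⟨-, h3⟩ := hcl _ hu _ hw h1.1
      obtain ⟨h4, -⟩ := hcl _ (hRf _ hu) _ (hRf _ hw) h1.2
      have h5 : (γ x) ^ 2 + b * γ x - ((γ y) ^ 2 + b * γ y) = γ c * (γ x + γ y + b) := by
        rw [hcdef, map_sub]; ring
      rw [h5, map_mul, h3, hvb] at h4
      calc v (γ c) = v (γ c) * WithZero.exp (1:ℤ) * WithZero.exp (-1:ℤ) := by
            rw [mul_assoc, ← WithZero.exp_add]; simp
        _ ≤ 1 * WithZero.exp (-1:ℤ) := mul_le_mul_left h4 _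
        _ = _ := one_mul _
    have hint : IsIntegral k[X] c := (hRi _ (hP _ x.2)).sub (hRi _ (hP _ y.2))
    have hni : IsIntegral k[X] (Algebra.norm κ c) := Algebra.isIntegral_norm κ hint
    obtain ⟨ζ, hζ⟩ := IsIntegrallyClosed.isIntegral_iff.1 hni
    have hζE : algebraMap k[X] E ζ = ∏ γ : E ≃ₐ[κ] E, γ c := by
      rw [IsScalarTower.algebraMap_apply k[X] κ E, hζ, Algebra.norm_eq_prod_automorphisms]
    have hprod0 : ∏ γ : E ≃ₐ[κ] E, γ c ≠ 0 :=
      Finset.prod_ne_zero_iff.2 fun γ _ => by simpa using hc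
    have hζ0 : ζ ≠ 0 := by
      rintro rfl
      exact hprod0 (by rw [← hζE, map_zero])
    have h6 := hv ζ hζ0
    have h7 : v (algebraMap k[X] E ζ) < 1 := by
      rw [hζE, map_prod]
      have hlt : WithZero.exp (-1 : ℤ) < 1 := by
        rw [← WithZero.exp_zero, WithZero.exp_lt_exp]; norm_num
      rw [← Finset.mul_prod_erase _ _ (Finset.mem_univ (1 : E ≃ₐ[κ] E))]
      refine lt_of_le_of_lt (mul_le_of_le_one_right' ?_) ((hγ 1).trans_lt hlt)
      exact Finset.prod_le_one' fun γ _ => (hγ γ).trans hlt.le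
    rw [h6, ← WithZero.exp_zero, WithZero.exp_lt_exp] at h7
    omega
  have hcard := Fintype.card_le_of_injective code hinj
  rw [Fintype.card_coe, Fintype.card_fun, Fintype.card_prod, Fintype.card_bool] at hcard
  refine hcard.trans ?_
  have hle : Fintype.card (L0 →ₐ[κ] E) ≤ Module.finrank κ L0 := by
    have := card_algHom_le_finrank κ L0 E
    rwa [Nat.card_eq_fintype_card] at this
  exact Nat.pow_le_pow_right (by norm_num) hle

end core3


section core2

theorem core2 {k E Ω : Type*} [Field k] [Field E] [Algebra (RatFunc k) E] [Algebra k[X] E]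
    [IsScalarTower k[X] (RatFunc k) E]
    [FiniteDimensional (RatFunc k) E] [IsGalois (RatFunc k) E]
    (v : Valuation E (WithZero (Multiplicative ℤ))) (σ : E →+* E) (p N : ℕ) (hp : 1 ≤ p)
    (hv : ∀ P : k[X], P ≠ 0 → v (algebraMap k[X] E P) = WithZero.exp (P.natDegree : ℤ))
    (hσv : ∀ y, v (σ y) = v y)
    (hσp : ∀ y, v y ≤ 1 → v (σ y - y ^ p) ≤ WithZero.exp (-1 : ℤ))
    (hσc : ∀ y, σ y = y ^ p → ∃ c : k, y = algebraMap k[X] E (C c))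
    (hσA : ∀ P : k[X], ∃ P' : k[X], σ (algebraMap k[X] E P) = algebraMap k[X] E P')
    (hσγ : ∀ (γ : E ≃ₐ[RatFunc k] E) y, σ (γ y) = γ (σ y))
    [Field Ω] [Algebra (RatFunc k) Ω] [Algebra k Ω] [IsScalarTower k (RatFunc k) Ω]
    (u : E →ₐ[RatFunc k] Ω) (P : Set Ω) (hP : P ⊆ Set.range u)
    (T : Ω) (hT : Transcendental k T)
    (hN : ∀ y : Fin (N + 1) → Ω,
      (∀ i, y i ∈ Submonoid.closure (insert (algebraMap (RatFunc k) Ω RatFunc.X) P)) →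
      ∃ c : Fin (N + 1) → k[X], c ≠ 0 ∧ ∑ i, aeval T (c i) * y i = 0) :
    Module.finrank (RatFunc k) (IntermediateField.adjoin (RatFunc k) P) ≤ (p + 1) * N ^ 2 := by
  classical
  set b := algebraMap (RatFunc k) Ω RatFunc.X with hb
  let ιA : k[X] →+* Ω := (algebraMap (RatFunc k) Ω).comp (algebraMap k[X] (RatFunc k))
  have hιC : ∀ a : k, ιA (C a) = algebraMap k Ω a := by
    intro a
    simp only [ιA, RingHom.comp_apply]
    rw [IsScalarTower.algebraMap_apply k (RatFunc k) Ω]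
    rfl
  have hιX : ιA X = b := by
    simp only [ιA, RingHom.comp_apply, RatFunc.algebraMap_X, hb]
  -- the relation for powers of b
  obtain ⟨c, hc0, hc⟩ := hN (fun i => b ^ (i : ℕ)) (fun i =>
    pow_mem (Submonoid.subset_closure (Set.mem_insert _ _)) _)
  let H : k[X][X] := ∑ i : Fin (N + 1), C (X ^ (i : ℕ)) * (c i).map C
  have hHcoeff : ∀ n, H.coeff n = ∑ i : Fin (N + 1), X ^ (i : ℕ) * C ((c i).coeff n) := by
    intro n
    simp only [H, finsetSum_coeff, coeff_C_mul, coeff_map]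
  have hHcc : ∀ n (i : Fin (N + 1)), (H.coeff n).coeff i = (c i).coeff n := by
    intro n i
    rw [hHcoeff, finsetSum_coeff, Finset.sum_eq_single i]
    · simp [mul_comm (X ^ _), coeff_C_mul, coeff_X_pow]
    · intro j _ hj
      rw [mul_comm, coeff_C_mul, coeff_X_pow, if_neg, mul_zero]
      intro h
      exact hj (Fin.ext h.symm)
    · simp
  have hH0 : H ≠ 0 := by
    intro h
    apply hc0
    funext i
    ext n
    rw [← hHcc n i, h]
    simp
  have hHN : ∀ n, (H.coeff n).natDegree ≤ N := by
    intro n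
    rw [hHcoeff]
    apply natDegree_sum_le_of_forall_le
    intro i _
    rw [mul_comm]
    refine (natDegree_C_mul_le _ _).trans ?_
    rw [natDegree_X_pow]
    omega
  have hHT : eval₂ ιA T H = 0 := by
    simp only [H]
    rw [eval₂_finsetSum, ← hc]
    refine Finset.sum_congr rfl fun i _ => ?_
    rw [eval₂_mul, eval₂_C, eval₂_map, map_pow, hιX, mul_comm]
    congr 1
    rw [aeval_def]
    congr 1
    ext a
    exact hιC a
  have hHT' : aeval T (H.map (algebraMap k[X] (RatFunc k))) = 0 := by
    rw [aeval_def, eval₂_map]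
    exact hHT
  have hinjA : Function.Injective (algebraMap k[X] (RatFunc k)) := IsFractionRing.injective _ _
  have hHmap0 : H.map (algebraMap k[X] (RatFunc k)) ≠ 0 := by
    rwa [Ne, Polynomial.map_eq_zero_iff hinjA]
  have hTalg : IsAlgebraic (RatFunc k) T := ⟨_, hHmap0, hHT'⟩
  have hTint : IsIntegral (RatFunc k) T := hTalg.isIntegral
  set M := minpoly (RatFunc k) T with hM
  have hMH : M ∣ H.map (algebraMap k[X] (RatFunc k)) := minpoly.dvd _ _ hHT'
  -- L0
  set L0 := IntermediateField.adjoin (RatFunc k) P with hL0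
  have hTint0 : IsIntegral L0 T := hTint.tower_top
  have hL0u : ∀ x ∈ L0, x ∈ Set.range u := by
    have : L0 ≤ u.fieldRange := IntermediateField.adjoin_le_iff.2 (by
      intro x hx
      exact hP hx)
    intro x hx
    exact this hx
  set G0 := (minpoly L0 T).map (algebraMap L0 Ω) with hG0
  have hG0m : G0.Monic := (minpoly.monic hTint0).map _
  obtain ⟨G, hGu, hGd, hGm⟩ := lifts_and_natDegree_eq_and_monic (f := (u : E →+* Ω)) (p := G0) (by
    rw [lifts_iff_coeff_lifts]
    intro n
    rw [hG0, coeff_map]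
    obtain ⟨y, hy⟩ := hL0u _ ((minpoly L0 T).coeff n).2
    exact ⟨y, hy⟩) hG0m
  have hGdeg : G.natDegree = (minpoly L0 T).natDegree := by
    rw [hGd, hG0, natDegree_map]
  have hGM : G ∣ M.map (algebraMap (RatFunc k) E) := by
    rw [← Polynomial.map_dvd_map' (u : E →+* Ω), hGu, Polynomial.map_map, hG0]
    have e1 : (u : E →+* Ω).comp (algebraMap (RatFunc k) E) = algebraMap (RatFunc k) Ω := u.comp_algebraMap
    rw [e1, IsScalarTower.algebraMap_eq (RatFunc k) L0 Ω, ← Polynomial.map_map]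
    apply Polynomial.map_dvd
    exact minpoly.dvd_map_of_isScalarTower _ _ _
  have huC : ∀ a : k, u (algebraMap k[X] E (C a)) = algebraMap k Ω a := by
    intro a
    rw [IsScalarTower.algebraMap_apply k[X] (RatFunc k) E, AlgHom.commutes]
    exact hιC a
  obtain ⟨i₀, hi₀⟩ : ∃ i, σ (G.coeff i) ≠ (G.coeff i) ^ p := by
    by_contra! hall
    apply hT
    have h1 : ∀ i, ∃ a : k, algebraMap k Ω a = G0.coeff i := by
      intro i
      obtain ⟨a, ha⟩ := hσc _ (hall i)
      refine ⟨a, ?_⟩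
      rw [← hGu, coeff_map, ← huC, ← ha]
      rfl
    obtain ⟨g, hg⟩ : ∃ g : k[X], g.map (algebraMap k Ω) = G0 := by
      rw [← mem_lifts, lifts_iff_coeff_lifts]
      intro n
      exact h1 n
    refine ⟨g, ?_, ?_⟩
    · rintro rfl
      rw [Polynomial.map_zero] at hg
      exact hG0m.ne_zero hg.symm
    · rw [← eval_map_algebraMap, hg, hG0, eval_map_algebraMap, minpoly.aeval]
  have hcore := core1 v σ p N hp hv hσv hσp hσA hσγ M (minpoly.monic hTint) (minpoly.irreducible hTint)
    H hH0 hHN hMH G hGm hGM i₀ hi₀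
  -- degrees
  set A := IntermediateField.adjoin (RatFunc k) ({T} : Set Ω) with hA
  have hd1 : Module.finrank (RatFunc k) L0 * (minpoly L0 T).natDegree =
      Module.finrank (RatFunc k) (IntermediateField.adjoin (RatFunc k) (P ∪ {T})) := by
    rw [← IntermediateField.adjoin.finrank hTint0, Module.finrank_mul_finrank,
      ← IntermediateField.adjoin_adjoin_left]
    rfl
  have hd2 : M.natDegree * Module.finrank A (IntermediateField.adjoin A P) =
      Module.finrank (RatFunc k) (IntermediateField.adjoin (RatFunc k) (P ∪ {T})) := by
    rw [← IntermediateField.adjoin.finrank hTint, Module.finrank_mul_finrank, Set.union_comm,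
      ← IntermediateField.adjoin_adjoin_left]
    rfl
  have hPalg : ∀ x ∈ P, IsAlgebraic A x := by
    intro x hx
    obtain ⟨y, rfl⟩ := hP hx
    have : IsAlgebraic (RatFunc k) (u y) := (Algebra.IsAlgebraic.isAlgebraic y).algHom u
    exact this.tower_top A
  have hd3 : Module.finrank A (IntermediateField.adjoin A P) ≤ N := by
    have e : Module.finrank A (IntermediateField.adjoin A P) =
        Module.finrank A (Submodule.span A (Submonoid.closure P : Set Ω)) := by
      rw [← Algebra.adjoin_eq_span, ← IntermediateField.adjoin_toSubalgebra_of_isAlgebraic hPalg]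
      rfl
    rw [e]
    apply finrank_span_le_of_dep
    intro y hy hli
    obtain ⟨d, hd0, hd⟩ := hN y (fun i => Submonoid.closure_mono (Set.subset_insert _ _) (hy i))
    have hmem : ∀ Q : k[X], aeval T Q ∈ A := by
      intro Q
      have : aeval T (Q.map (algebraMap k (RatFunc k))) ∈ A := by
        exact IntermediateField.algebra_adjoin_le_adjoin _ _ (Polynomial.aeval_mem_adjoin_singleton _ _)
      rwa [aeval_map_algebraMap] at this
    rw [Fintype.linearIndependent_iff] at hli
    have := hli (fun i => ⟨aeval T (d i), hmem _⟩) (by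
      rw [← hd]
      rfl)
    apply hd0
    funext i
    have h2 := congrArg Subtype.val (this i)
    by_contra h3
    exact hT ⟨d i, h3, h2⟩
  have hr : 0 < (minpoly L0 T).natDegree := minpoly.natDegree_pos hTint0
  rw [hGdeg] at hcore
  have : Module.finrank (RatFunc k) L0 * (minpoly L0 T).natDegree ≤ ((p + 1) * N ^ 2) * (minpoly L0 T).natDegree := by
    rw [hd1, ← hd2]
    calc _ ≤ (N * (p + 1) * (minpoly L0 T).natDegree) * N := Nat.mul_le_mul hcore hd3
      _ = _ := by ring
  exact Nat.le_of_mul_le_mul_right this hr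

end core2


universe u1 u2

lemma common_IJ {S : Type*} (g : S → S) (P : Finset S)
    (hP : ∀ x ∈ P, (Set.range fun n : ℕ => g^[n] x).Finite) :
    ∃ I J : ℕ, 1 ≤ J ∧ ∀ x ∈ P, g^[I + J] x = g^[I] x := by
  classical
  have shift : ∀ (x : S) (i j : ℕ), g^[i + j] x = g^[i] x → ∀ i' m, g^[(i + i') + j * m] x = g^[i + i'] x := by
    intro x i j h i' m
    induction m with
    | zero => simp
    | succ m ih =>
      have e : i + i' + j * (m + 1) = (i' + j * m) + (i + j) := by ring
      rw [e, Function.iterate_add_apply, h, ← Function.iterate_add_apply, ← ih]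
      have e2 : i' + j * m + i = i + i' + j * m := by ring
      rw [e2]
  induction P using Finset.induction_on with
  | empty => exact ⟨0, 1, le_rfl, by simp⟩
  | insert a s ha ih =>
    obtain ⟨I, J, hJ, h⟩ := ih (fun x hx => hP x (Finset.mem_insert_of_mem hx))
    have hni : ¬ Function.Injective (fun n : ℕ => g^[n] a) := fun hi =>
      Set.infinite_range_of_injective hi (hP a (Finset.mem_insert_self _ _))
    have : ∃ i j : ℕ, 1 ≤ j ∧ g^[i + j] a = g^[i] a := by
      rw [Function.not_injective_iff] at hni
      obtain ⟨m, n, hmn, hne⟩ := hni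
      rcases lt_or_gt_of_ne hne with h1 | h1
      · refine ⟨m, n - m, by omega, ?_⟩
        rw [Nat.add_sub_cancel' h1.le]; exact hmn.symm
      · refine ⟨n, m - n, by omega, ?_⟩
        rw [Nat.add_sub_cancel' h1.le]; exact hmn
    obtain ⟨i, j, hj, hij⟩ := this
    refine ⟨I + i, J * j, Nat.mul_pos hJ hj, ?_⟩
    intro x hx
    rw [Finset.mem_insert] at hx
    rcases hx with rfl | hx
    · have := shift x i j hij I J
      rw [mul_comm J j, add_comm I i]
      exact this
    · exact shift x I J (h x hx) i j

lemma qF_eval {R : Type*} [CommRing R] (b z : R) (I J : ℕ) :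
    (qF b I J).eval z = (fun z => z ^ 2 + b * z)^[I + J] z - (fun z => z ^ 2 + b * z)^[I] z := by
  rw [qF, eval_sub, qit_eval, qit_eval]

/-- The embedding of the rational function field given by a transcendental element. -/
noncomputable def ratEmb {k : Type u1} [Field k] {Ω : Type u2} [Field Ω] [Algebra k Ω] (b : Ω)
    (hb : Transcendental k b) : RatFunc k →+* Ω :=
  IsFractionRing.lift (A := k[X]) (g := (aeval b : k[X] →ₐ[k] Ω).toRingHom)
    (transcendental_iff_injective.1 hb)

lemma ratEmb_algebraMap {k : Type u1} [Field k] {Ω : Type u2} [Field Ω] [Algebra k Ω] (b : Ω)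
    (hb : Transcendental k b) (P : k[X]) : ratEmb b hb (algebraMap k[X] (RatFunc k) P) = aeval b P :=
  IsFractionRing.lift_algebraMap _ _

lemma ratEmb_X {k : Type u1} [Field k] {Ω : Type u2} [Field Ω] [Algebra k Ω] (b : Ω)
    (hb : Transcendental k b) : ratEmb b hb RatFunc.X = b := by
  rw [← RatFunc.algebraMap_X, ratEmb_algebraMap, aeval_X]

lemma ratEmb_C {k : Type u1} [Field k] {Ω : Type u2} [Field Ω] [Algebra k Ω] (b : Ω)
    (hb : Transcendental k b) (a : k) : ratEmb b hb (algebraMap k (RatFunc k) a) = algebraMap k Ω a := by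
  rw [IsScalarTower.algebraMap_apply k k[X] (RatFunc k), ratEmb_algebraMap, Polynomial.algebraMap_eq, aeval_C]

lemma qF_separable (k : Type u1) [Field k] (p : ℕ) [Fact p.Prime] [CharP k p] (I J : ℕ) (hJ : 1 ≤ J)
    {Ω : Type u2} [Field Ω] [Algebra k Ω] (b : Ω) (hb : Transcendental k b) :
    (qF b I J).Separable := by
  obtain ⟨E, _, _, v, σ, -, hs, -⟩ := galois_exists k p I J hJ
  have := hs.map (f := ratEmb b hb)
  rwa [qF_map, ratEmb_X] at this

theorem coreP (k : Type u1) [Field k] (p : ℕ) [Fact p.Prime] [CharP k p] (I J : ℕ) (hJ : 1 ≤ J)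
    {Ω : Type u2} [Field Ω] [IsAlgClosed Ω] [Algebra k Ω] (b T : Ω) (hb : Transcendental k b)
    (hT : Transcendental k T) (N : ℕ) (P : Finset Ω) (hP : ∀ x ∈ P, (qF b I J).eval x = 0)
    (hN : ∀ y : Fin (N + 1) → Ω, (∀ i, y i ∈ Submonoid.closure (insert b (P : Set Ω))) →
      ∃ c : Fin (N + 1) → k[X], c ≠ 0 ∧ ∑ i, aeval T (c i) * y i = 0) :
    P.card ≤ 4 ^ ((p + 1) * N ^ 2) := by
  classical
  obtain ⟨E, _, _, v, σ, hE, hs, hv, hσv, hσp, hσc, hσA, hσγ, hroot⟩ := galois_exists k p I J hJ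
  set F := qF (RatFunc.X : RatFunc k) I J with hF
  let _ : Algebra k[X] E := ((algebraMap (RatFunc k) E).comp (algebraMap k[X] (RatFunc k))).toAlgebra
  have : IsScalarTower k[X] (RatFunc k) E := IsScalarTower.of_algebraMap_eq fun _ => rfl
  have hFD : FiniteDimensional (RatFunc k) E := IsSplittingField.finiteDimensional E F
  have : IsGalois (RatFunc k) E := IsGalois.of_separable_splitting_field hs
  let _ : Algebra (RatFunc k) Ω := (ratEmb b hb).toAlgebra
  have hκΩ : ∀ y, algebraMap (RatFunc k) Ω y = ratEmb b hb y := fun _ => rfl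
  have : IsScalarTower k (RatFunc k) Ω := IsScalarTower.of_algebraMap_eq fun a => by
    rw [hκΩ, ratEmb_C]
  have hXb : algebraMap (RatFunc k) Ω RatFunc.X = b := by rw [hκΩ, ratEmb_X]
  have hFΩ : F.map (algebraMap (RatFunc k) Ω) = qF b I J := by rw [hF, qF_map, hXb]
  let u : E →ₐ[RatFunc k] Ω := IsSplittingField.lift E F (IsAlgClosed.splits _)
  have huinj : Function.Injective u := u.toRingHom.injective
  have hF0 : F ≠ 0 := (qF_monic _ I J hJ).1.ne_zero
  have hsub : ∀ x : Ω, (qF b I J).eval x = 0 → ∃ y : E, (F.map (algebraMap (RatFunc k) E)).IsRoot y ∧ u y = x := by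
    intro x hx
    have hspl := IsSplittingField.splits E F
    have h2 : (F.map (algebraMap (RatFunc k) E)).map (u : E →+* Ω) = qF b I J := by
      rw [Polynomial.map_map, ← hFΩ]
      congr 1
      exact u.comp_algebraMap
    have h3 := hspl.roots_map (u : E →+* Ω)
    rw [h2] at h3
    have hx' : x ∈ (qF b I J).roots := (mem_roots (qF_monic b I J hJ).1.ne_zero).2 hx
    rw [h3, Multiset.mem_map] at hx'
    obtain ⟨y, hy, rfl⟩ := hx'
    exact ⟨y, isRoot_of_mem_roots hy, rfl⟩
  let PE : Finset E := P.preimage u huinj.injOn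
  have hPE : u '' (PE : Set E) = P := by
    ext x
    constructor
    · rintro ⟨y, hy, rfl⟩
      exact Finset.mem_preimage.1 hy
    · intro hx
      obtain ⟨y, -, rfl⟩ := hsub x (hP x hx)
      exact ⟨y, Finset.mem_preimage.2 hx, rfl⟩
  have hcard : PE.card = P.card := by
    rw [← Finset.card_image_of_injective PE huinj]
    congr 1
    apply Finset.coe_injective
    rw [Finset.coe_image, hPE]
  have hq : ∀ x : E, (F.map (algebraMap (RatFunc k) E)).IsRoot x ↔
      (qF (algebraMap (RatFunc k) E RatFunc.X) I J).eval x = 0 := by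
    intro x
    rw [hF, qF_map, IsRoot]
  have hXE : algebraMap k[X] E X = algebraMap (RatFunc k) E RatFunc.X := by
    rw [IsScalarTower.algebraMap_apply k[X] (RatFunc k) E, RatFunc.algebraMap_X]
  have h3 := core3 (k := k) (κ := RatFunc k) v hv {x : E | (F.map (algebraMap (RatFunc k) E)).IsRoot x}
    (by
      intro γ x hx
      simp only [Set.mem_ofPred_eq, IsRoot, eval_map_algebraMap] at hx ⊢
      rw [aeval_algHom_apply γ x F, hx, map_zero])
    (by
      intro x hx
      simp only [Set.mem_ofPred_eq, hq] at hx ⊢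
      rw [qF_eval, sub_eq_zero] at hx ⊢
      rw [hXE]
      have := congrArg (fun z => z ^ 2 + algebraMap (RatFunc k) E RatFunc.X * z) hx
      rw [← Function.iterate_succ_apply' (fun z => z ^ 2 + algebraMap (RatFunc k) E RatFunc.X * z),
        ← Function.iterate_succ_apply' (fun z => z ^ 2 + algebraMap (RatFunc k) E RatFunc.X * z)] at this
      exact this)
    (by
      intro x hx
      refine ⟨qF X I J, (qF_monic _ I J hJ).1, ?_⟩
      rw [← eval_map, qF_map, hXE]
      exact (hq x).1 hx)
    (by
      intro x hx
      rw [hXE]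
      exact hroot x hx)
    PE (by
      intro x hx
      obtain ⟨y, hy, hyx⟩ := hsub (u x) (hP _ (Finset.mem_preimage.1 hx))
      rw [← huinj hyx]
      exact hy)
  have h2 := core2 (k := k) v σ p N (Fact.out : p.Prime).one_le hv hσv hσp hσc hσA hσγ u (P : Set Ω)
    (by rw [← hPE]; exact Set.image_subset_range _ _) T hT (by rw [hXb]; exact hN)
  have hfr : Module.finrank (RatFunc k) (IntermediateField.adjoin (RatFunc k) (PE : Set E)) =
      Module.finrank (RatFunc k) (IntermediateField.adjoin (RatFunc k) (P : Set Ω)) := by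
    rw [← hPE, ← IntermediateField.adjoin_map]
    exact ((IntermediateField.equivMap _ u).toLinearEquiv).finrank_eq
  rw [← hcard]
  refine h3.trans (Nat.pow_le_pow_right (by norm_num) ?_)
  rw [hfr]
  exact h2


lemma place_ext {A Ω : Type*} [CommRing A] [Field Ω] (i : A →+* Ω) (q : Ideal A) [q.IsPrime]
    (h : RingHom.ker i ≤ q) : ∃ O : ValuationSubring Ω, ∀ a, i a ∈ O ∧ (i a ∈ O.nonunits ↔ a ∈ q) := by
  have hu : ∀ y : q.primeCompl, IsUnit (i y) := by
    intro y
    rw [isUnit_iff_ne_zero]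
    intro h0
    exact y.2 (h h0)
  let j : Localization.AtPrime q →+* Ω := IsLocalization.lift (M := q.primeCompl) hu
  have hj : ∀ a, j (algebraMap A _ a) = i a := fun a => IsLocalization.lift_eq hu a
  have hsurj := j.rangeRestrict_surjective
  obtain ⟨O, hO1, hO2⟩ := Ideal.image_subset_nonunits_valuationSubring (A := j.range)
    ((IsLocalRing.maximalIdeal (Localization.AtPrime q)).map j.rangeRestrict) (by
      rw [Ne, Ideal.eq_top_iff_one]
      intro h1
      obtain ⟨x, hx, hx1⟩ := (Ideal.mem_map_iff_of_surjective _ hsurj).1 h1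
      have hx2 : j x = 1 := congrArg Subtype.val hx1
      have hun : IsUnit (1 - x) := IsLocalRing.isUnit_one_sub_self_of_mem_nonunits x hx
      have := hun.map j
      rw [map_sub, map_one, hx2, sub_self] at this
      exact not_isUnit_zero this)
  have hmem : ∀ y, j y ∈ O := fun y => hO1 ⟨y, rfl⟩
  refine ⟨O, fun a => ⟨by rw [← hj]; exact hmem _, ?_, ?_⟩⟩
  · intro ha
    by_contra hq
    rw [ValuationSubring.mem_nonunits_iff_or] at ha
    have h2 : i a * j (IsLocalization.mk' (Localization.AtPrime q) (1 : A)
        (⟨a, hq⟩ : q.primeCompl)) = 1 := by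
      rw [← hj, ← map_mul, IsLocalization.mul_mk'_eq_mk'_of_mul, mul_one]
      have := IsLocalization.mk'_self (Localization.AtPrime q) (M := q.primeCompl) (x := a) hq
      rw [this, map_one]
    rcases ha with ha | ha
    · rw [ha, zero_mul] at h2
      exact zero_ne_one h2
    · apply ha
      rw [← eq_inv_of_mul_eq_one_right h2]
      exact hmem _
  · intro ha
    apply hO2
    refine ⟨j.rangeRestrict (algebraMap A _ a), Ideal.mem_map_of_mem _ ?_, hj a⟩
    rw [← IsLocalization.AtPrime.map_eq_maximalIdeal q]
    exact Ideal.mem_map_of_mem _ ha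

lemma exists_places {k1 Ω : Type*} [Field k1] [CharZero k1] [Field Ω] [Algebra k1 Ω] (b : Ω)
    (hb : Transcendental k1 b) :
    ∃ (Ok : ValuationSubring k1) (O : ValuationSubring Ω), (2 : k1) ∈ Ok.nonunits ∧
      (∀ x : k1, x ∈ Ok ↔ algebraMap k1 Ω x ∈ O) ∧
      (∀ P : Ok[X], aeval b (P.map Ok.subtype) ∈ O ∧
        (aeval b (P.map Ok.subtype) ∈ O.nonunits ↔ P.map (IsLocalRing.residue Ok) = 0)) := by
  have hpr : (Ideal.span {(2 : ℤ)}).IsPrime :=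
    (Ideal.span_singleton_prime (by norm_num)).2 Int.prime_two
  obtain ⟨Ok, hOk⟩ := place_ext (Int.castRingHom k1) (Ideal.span {(2 : ℤ)}) (by
    intro x hx
    have : ((x : ℤ) : k1) = 0 := hx
    rw [Int.cast_eq_zero.1 this]
    exact zero_mem _)
  let i : Ok[X] →+* Ω := (aeval b : k1[X] →ₐ[k1] Ω).toRingHom.comp (mapRingHom Ok.subtype)
  have hi : ∀ P, i P = aeval b (P.map Ok.subtype) := fun _ => rfl
  have hiC : ∀ x : Ok, i (C x) = algebraMap k1 Ω x := by
    intro x; rw [hi, map_C, aeval_C]; rfl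
  have hpr2 : (RingHom.ker (mapRingHom (IsLocalRing.residue Ok))).IsPrime := by
    have : IsDomain (IsLocalRing.ResidueField Ok)[X] := inferInstance
    exact RingHom.ker_isPrime _
  obtain ⟨O, hO⟩ := place_ext i (RingHom.ker (mapRingHom (IsLocalRing.residue Ok))) (by
    intro P hP
    have h1 : aeval b (P.map Ok.subtype) = 0 := hP
    have h2 : P.map Ok.subtype = 0 := by
      by_contra h3
      exact hb ⟨_, h3, h1⟩
    have h3 : P = 0 := (Polynomial.map_eq_zero_iff Subtype.val_injective).1 h2
    rw [h3]; exact zero_mem _)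
  refine ⟨Ok, O, ?_, ?_, ?_⟩
  · have := (hOk 2).2.2 (Ideal.mem_span_singleton_self _)
    simpa using this
  · intro x
    constructor
    · intro hx
      rw [← hiC ⟨x, hx⟩]
      exact (hO _).1
    · intro hx
      by_contra hx2
      have hx0 : x ≠ 0 := by rintro rfl; exact hx2 (zero_mem _)
      have h1 : x⁻¹ ∈ Ok := (Ok.mem_or_inv_mem x).resolve_left hx2
      have h2 : x⁻¹ ∈ Ok.nonunits := by
        rw [ValuationSubring.inv_mem_nonunits_iff]; exact Or.inr hx2
      have h3 : i (C ⟨x⁻¹, h1⟩) ∈ O.nonunits := by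
        rw [(hO _).2, RingHom.mem_ker, coe_mapRingHom, map_C, C_eq_zero, IsLocalRing.residue_eq_zero_iff]
        rw [← Ok.coe_mem_nonunits_iff]
        exact h2
      rw [hiC, map_inv₀, ValuationSubring.inv_mem_nonunits_iff] at h3
      rcases h3 with h3 | h3
      · exact hx0 ((map_eq_zero _).1 h3)
      · exact h3 hx
  · intro P
    exact hO P


theorem find_T {k1 Ω κ Ω' : Type*} [Field k1] [IsAlgClosed k1] [Field Ω] [Algebra k1 Ω]
    [Field κ] [Field Ω'] [Algebra κ Ω'] (Ok : ValuationSubring k1) (O : ValuationSubring Ω)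
    (ρk : Ok →+* κ) (ρ : O →+* Ω') (hloc : ∀ x : O, (x : Ω) ∈ O.nonunits → ρ x = 0)
    (hk : ∀ x : k1, x ∈ Ok → algebraMap k1 Ω x ∈ O)
    (hk' : ∀ x : k1, algebraMap k1 Ω x ∈ O → x ∈ Ok)
    (hρ : ∀ (x : k1) (hx : x ∈ Ok), ρ ⟨algebraMap k1 Ω x, hk x hx⟩ = algebraMap κ Ω' (ρk ⟨x, hx⟩))
    (b : O) (hb : Transcendental κ (ρ b)) (T : Ω) (hT : Transcendental k1 T) (N : ℕ)
    (hN : ∃ c : Fin (N + 1) → k1[X], c ≠ 0 ∧ ∑ i, aeval T (c i) * (b : Ω) ^ (i : ℕ) = 0) :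
    ∃ (a c : k1) (_ : c ≠ 0) (h : (T - algebraMap k1 Ω a) / algebraMap k1 Ω c ∈ O),
      Transcendental κ (ρ ⟨_, h⟩) := by
  classical
  by_contra hcon
  push Not at hcon
  set w := O.valuation with hw
  set φ := algebraMap k1 Ω with hφ
  have hmemO : ∀ x : Ω, x ∈ O ↔ w x ≤ 1 := fun x => (O.valuation_le_one_iff x).symm
  -- the subring of elements with algebraic residue
  let S : Subring Ω := ((algebraicClosure κ Ω').toSubring.comap ρ).map O.subtype
  have hS : ∀ x : Ω, x ∈ S ↔ ∃ h : x ∈ O, IsAlgebraic κ (ρ ⟨x, h⟩) := by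
    intro x
    constructor
    · rintro ⟨y, hy, rfl⟩
      exact ⟨y.2, mem_algebraicClosure_iff.1 hy⟩
    · rintro ⟨h, ha⟩
      exact ⟨⟨x, h⟩, mem_algebraicClosure_iff.2 ha, rfl⟩
  have hSlt : ∀ x : Ω, w x < 1 → x ∈ S := by
    intro x hx
    rw [hS]
    have hxO : x ∈ O := (hmemO x).2 hx.le
    refine ⟨hxO, ?_⟩
    rw [hloc ⟨x, hxO⟩ (O.mem_nonunits_iff.2 hx)]
    exact isAlgebraic_zero
  have hSinv : ∀ x : Ω, w x = 1 → x ∈ S → x⁻¹ ∈ S := by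
    intro x hx1 hx
    rw [hS] at hx ⊢
    obtain ⟨h, ha⟩ := hx
    have h' : x⁻¹ ∈ O := by rw [hmemO, map_inv₀, hx1, inv_one]
    have hx0 : x ≠ 0 := by rintro rfl; simp at hx1
    refine ⟨h', ?_⟩
    have e : ρ ⟨x⁻¹, h'⟩ = (ρ ⟨x, h⟩)⁻¹ := by
      apply eq_inv_of_mul_eq_one_left
      rw [← map_mul, ← map_one ρ]
      congr 1
      apply Subtype.ext
      exact inv_mul_cancel₀ hx0
    rw [e]
    exact ha.inv
  have hSk : ∀ x : k1, w (φ x) ≤ 1 → φ x ∈ S := by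
    intro x hx
    rw [hS]
    have hxk := hk' x ((hmemO _).2 hx)
    refine ⟨hk x hxk, ?_⟩
    rw [hρ x hxk]
    exact isAlgebraic_algebraMap _
  have hlin : ∀ a c : k1, c ≠ 0 → w ((T - φ a) / φ c) ≤ 1 → (T - φ a) / φ c ∈ S := by
    intro a c hc h
    rw [hS]
    have := hcon a c hc ((hmemO _).2 h)
    unfold Transcendental at this
    rw [not_not] at this
    exact ⟨_, this⟩
  have hTa : ∀ a, T - φ a ≠ 0 := by
    intro a h
    apply hT
    refine ⟨X - C a, X_sub_C_ne_zero a, ?_⟩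
    rw [map_sub, aeval_X, aeval_C]; exact h
  have hφ0 : ∀ c, c ≠ 0 → φ c ≠ 0 := fun c hc => (map_ne_zero φ).2 hc
  -- key: existence of τ
  obtain ⟨τ, hτ0, hτS, hτT⟩ : ∃ τ : Ω, τ ≠ 0 ∧
      (∀ (c : k1) (e : ℤ), c ≠ 0 → w (φ c * τ ^ e) = 1 → φ c * τ ^ e ∈ S) ∧
      (∀ a : k1, ∃ (c : k1) (e : ℤ) (u : Ω), c ≠ 0 ∧ w u = 1 ∧ u ∈ S ∧ T - φ a = φ c * τ ^ e * u) := by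
    by_cases hA : ∀ a : k1, ∃ c : k1, c ≠ 0 ∧ w (T - φ a) = w (φ c)
    · refine ⟨1, one_ne_zero, ?_, ?_⟩
      · intro c e hc h
        rw [one_zpow, mul_one] at h ⊢
        exact hSk c h.le
      · intro a
        obtain ⟨c, hc, h⟩ := hA a
        have h1 : w ((T - φ a) / φ c) = 1 := by
          rw [map_div₀, h, div_self]
          exact (Valuation.ne_zero_iff w).2 (hφ0 c hc)
        refine ⟨c, 0, (T - φ a) / φ c, hc, h1, hlin a c hc h1.le, ?_⟩
        rw [zpow_zero, mul_one, mul_div_cancel₀ _ (hφ0 c hc)]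
    · push Not at hA
      obtain ⟨a0, ha0⟩ := hA
      have hτ0 := hTa a0
      set τ := T - φ a0 with hτ
      have hpow : ∀ (c : k1) (n : ℕ), c ≠ 0 → n ≠ 0 → w τ ^ n ≠ w (φ c) := by
        intro c n hc hn h
        obtain ⟨d, hd⟩ := IsAlgClosed.exists_pow_nat_eq c (Nat.pos_of_ne_zero hn)
        have hd0 : d ≠ 0 := by
          rintro rfl
          rw [zero_pow hn] at hd
          exact hc hd.symm
        rw [← hd, map_pow, map_pow] at h
        exact ha0 d hd0 ((pow_left_inj₀ zero_le zero_le hn).1 h)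
      refine ⟨τ, hτ0, ?_, ?_⟩
      · intro c e hc h
        have he : e = 0 := by
          by_contra he
          obtain ⟨n, rfl | rfl⟩ := Int.eq_nat_or_neg e
          · have hn : n ≠ 0 := by rintro rfl; simp at he
            apply hpow c⁻¹ n (inv_ne_zero hc) hn
            rw [zpow_natCast, map_mul, map_pow] at h
            rw [map_inv₀, map_inv₀]
            exact eq_inv_of_mul_eq_one_right h
          · have hn : n ≠ 0 := by rintro rfl; simp at he
            apply hpow c n hc hn
            rw [zpow_neg, zpow_natCast, map_mul, map_inv₀, map_pow] at h
            have := eq_inv_of_mul_eq_one_left h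
            rw [inv_inv] at this
            exact this.symm
        rw [he, zpow_zero, mul_one] at h ⊢
        exact hSk c h.le
      · intro a
        have e1 : T - φ a = τ + φ (a0 - a) := by rw [hτ, map_sub]; ring
        have hsmall : ∀ x, w x < 1 → w (1 + x) = 1 ∧ 1 + x ∈ S := by
          intro x hx
          refine ⟨?_, add_mem (one_mem _) (hSlt x hx)⟩
          rw [Valuation.map_add_eq_of_lt_left, map_one]
          rwa [map_one]
        by_cases haa : a0 - a = 0
        · refine ⟨1, 1, 1, one_ne_zero, map_one _, one_mem _, ?_⟩
          rw [e1, haa, map_zero, map_one]; simp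
        · have hne := ha0 (a0 - a) haa
          rcases lt_or_gt_of_ne hne with h1 | h1
          · have h2 : w (τ / φ (a0 - a)) < 1 := by
              rw [map_div₀]
              exact (div_lt_one₀ (lt_of_le_of_lt zero_le h1)).2 h1
            obtain ⟨h3, h4⟩ := hsmall _ h2
            refine ⟨a0 - a, 0, _, haa, h3, h4, ?_⟩
            rw [e1]
            have h5 := hφ0 _ haa
            rw [zpow_zero, mul_one, mul_add, mul_one, mul_div_cancel₀ _ h5, add_comm]
          · have h2 : w (φ (a0 - a) / τ) < 1 := by
              rw [map_div₀]
              exact (div_lt_one₀ (lt_of_le_of_lt zero_le h1)).2 h1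
            obtain ⟨h3, h4⟩ := hsmall _ h2
            refine ⟨1, 1, _, one_ne_zero, h3, h4, ?_⟩
            rw [e1, map_one]
            field_simp
  let V : Ω → Prop := fun x => ∃ (c : k1) (e : ℤ) (u : Ω), c ≠ 0 ∧ w u = 1 ∧ u ∈ S ∧ x = φ c * τ ^ e * u
  have hV1 : ∀ c, c ≠ 0 → V (φ c) := fun c hc => ⟨c, 0, 1, hc, map_one _, one_mem _, by simp⟩
  have hVmul : ∀ x y, V x → V y → V (x * y) := by
    rintro x y ⟨c, e, u, h1, h2, h3, rfl⟩ ⟨c', e', u', h1', h2', h3', rfl⟩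
    refine ⟨c * c', e + e', u * u', mul_ne_zero h1 h1', by rw [map_mul, h2, h2', one_mul],
      mul_mem h3 h3', ?_⟩
    rw [map_mul, zpow_add₀ hτ0]; ring
  have hVinv : ∀ x, V x → V x⁻¹ := by
    rintro x ⟨c, e, u, h1, h2, h3, rfl⟩
    refine ⟨c⁻¹, -e, u⁻¹, inv_ne_zero h1, by rw [map_inv₀, h2, inv_one], hSinv u h2 h3, ?_⟩
    rw [map_inv₀, zpow_neg, mul_inv, mul_inv]
  have hVS : ∀ x, V x → w x ≤ 1 → x ∈ S := by
    rintro x ⟨c, e, u, h1, h2, h3, rfl⟩ hx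
    rcases lt_or_eq_of_le hx with h | h
    · exact hSlt _ h
    · refine mul_mem (hτS c e h1 ?_) h3
      rwa [map_mul, h2, mul_one] at h
  have hVP : ∀ P : k1[X], P ≠ 0 → V (aeval T P) := by
    intro P hP
    rw [(IsAlgClosed.splits P).eq_prod_roots, map_mul, aeval_C]
    refine hVmul _ _ (hV1 _ (leadingCoeff_ne_zero.2 hP)) ?_
    rw [map_multiset_prod, Multiset.map_map]
    apply Multiset.prod_induction V _ hVmul
    · have := hV1 1 one_ne_zero
      rwa [map_one] at this
    · intro x hx
      rw [Multiset.mem_map] at hx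
      obtain ⟨a, -, rfl⟩ := hx
      simp only [Function.comp, map_sub, aeval_X, aeval_C]
      exact hτT a
  -- the relation
  obtain ⟨c, hc0, hc⟩ := hN
  obtain ⟨j, -, hj⟩ := Finset.exists_max_image (Finset.univ : Finset (Fin (N + 1)))
    (fun i => w (aeval T (c i))) ⟨0, Finset.mem_univ _⟩
  obtain ⟨i0, hi0⟩ := Function.ne_iff.1 hc0
  have hne0 : ∀ P : k1[X], P ≠ 0 → aeval T P ≠ 0 := fun P hP h => hT ⟨P, hP, h⟩
  have hj0 : aeval T (c j) ≠ 0 := by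
    intro h
    have h1 := hj i0 (Finset.mem_univ _)
    rw [h, map_zero, le_zero_iff, map_eq_zero] at h1
    exact hne0 _ hi0 h1
  have hr : ∀ i, aeval T (c i) / aeval T (c j) ∈ S := by
    intro i
    by_cases hci : c i = 0
    · rw [hci, map_zero, zero_div]; exact zero_mem _
    · apply hVS
      · rw [div_eq_mul_inv]
        refine hVmul _ _ (hVP _ hci) (hVinv _ (hVP _ ?_))
        intro h
        rw [h, map_zero] at hj0
        exact hj0 rfl
      · rw [map_div₀]
        exact div_le_one_of_le₀ (hj i (Finset.mem_univ _)) zero_le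
  choose hrO hra using fun i => (hS _).1 (hr i)
  have hsum : ∑ i : Fin (N + 1), ρ ⟨_, hrO i⟩ * (ρ b) ^ (i : ℕ) = 0 := by
    simp only [← map_pow, ← map_mul, ← map_sum]
    rw [← map_zero ρ]
    congr 1
    apply Subtype.ext
    rw [AddSubmonoidClass.coe_finsetSum]
    simp only [MulMemClass.coe_mul, SubmonoidClass.coe_pow, ZeroMemClass.coe_zero]
    have h1 : ∀ i : Fin (N + 1), aeval T (c i) / aeval T (c j) * (b : Ω) ^ (i : ℕ) =
      (aeval T (c j))⁻¹ * (aeval T (c i) * (b : Ω) ^ (i : ℕ)) := by intro i; ring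
    simp only [h1, ← Finset.mul_sum, hc, mul_zero]
  -- b is algebraic over the algebraic closure
  have hbalg : IsAlgebraic (algebraicClosure κ Ω') (ρ b) := by
    refine ⟨∑ i : Fin (N + 1), C ⟨ρ ⟨_, hrO i⟩, mem_algebraicClosure_iff.2 (hra i)⟩ * X ^ (i : ℕ), ?_, ?_⟩
    · intro h
      have h1 := congrArg (fun Q => coeff Q (j : ℕ)) h
      simp only [finsetSum_coeff, coeff_C_mul, coeff_X_pow, coeff_zero] at h1
      rw [Finset.sum_eq_single j] at h1
      · rw [if_pos rfl, mul_one] at h1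
        have h2 := congrArg Subtype.val h1
        simp only [div_self hj0] at h2
        have h3 : ρ 1 = 0 := h2
        rw [map_one] at h3
        exact one_ne_zero h3
      · intro i _ hij
        rw [if_neg, mul_zero]
        intro h
        exact hij (Fin.ext h.symm)
      · intro h; exact absurd (Finset.mem_univ _) h
    · rw [map_sum, ← hsum]
      refine Finset.sum_congr rfl fun i _ => ?_
      rw [map_mul, aeval_C, map_pow, aeval_X]
      rfl
  have : Algebra.IsAlgebraic κ (algebraicClosure κ Ω') := inferInstance
  exact hb (hbalg.restrictScalars κ)


universe u3 u4

lemma scale_family {k1 : Type*} [Field k1] (Ok : ValuationSubring k1) {n : ℕ} (c : Fin n → k1[X])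
    (hc : c ≠ 0) : ∃ s : k1, s ≠ 0 ∧ ∃ e : Fin n → Ok[X], (∀ i, (e i).map Ok.subtype = C s * c i) ∧
      ∃ i m, (e i).coeff m = 1 := by
  classical
  obtain ⟨i0, hi0⟩ := Function.ne_iff.1 hc
  obtain ⟨⟨j, m⟩, hjm, hmax⟩ := Finset.exists_max_image
    ((Finset.univ : Finset (Fin n)).sigma (fun i => (c i).support))
    (fun x => Ok.valuation ((c x.1).coeff x.2))
    (by
      obtain ⟨m, hm⟩ := (nonempty_support_iff.2 hi0)
      exact ⟨⟨i0, m⟩, Finset.mem_sigma.2 ⟨Finset.mem_univ _, hm⟩⟩)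
  have h0 : (c j).coeff m ≠ 0 := mem_support_iff.1 (Finset.mem_sigma.1 hjm).2
  have hl : ∀ i, ∃ e : Ok[X], e.map Ok.subtype = C ((c j).coeff m)⁻¹ * c i := by
    intro i
    rw [← mem_lifts, lifts_iff_coeff_lifts]
    intro l
    rw [coeff_C_mul]
    have : ((c j).coeff m)⁻¹ * (c i).coeff l ∈ Ok := by
      rw [← Ok.valuation_le_one_iff, map_mul, map_inv₀]
      by_cases hl : (c i).coeff l = 0
      · rw [hl, map_zero, mul_zero]; exact zero_le
      · have := hmax ⟨i, l⟩ (Finset.mem_sigma.2 ⟨Finset.mem_univ _, mem_support_iff.2 hl⟩)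
        rw [mul_comm, ← div_eq_mul_inv]
        exact div_le_one_of_le₀ this zero_le
    exact ⟨⟨_, this⟩, rfl⟩
  choose e he using hl
  refine ⟨_, inv_ne_zero h0, e, he, j, m, ?_⟩
  apply Subtype.ext
  have := congrArg (fun Q => coeff Q m) (he j)
  simp only [coeff_map, coeff_C_mul, inv_mul_cancel₀ h0] at this
  exact this

theorem core0 {k1 : Type u3} [Field k1] [IsAlgClosed k1] [CharZero k1] (I J : ℕ) (hJ : 1 ≤ J)
    {Ω : Type u4} [Field Ω] [Algebra k1 Ω] (b T : Ω) (hb : Transcendental k1 b)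
    (hT : Transcendental k1 T) (N : ℕ) (P : Finset Ω) (hP : ∀ x ∈ P, (qF b I J).eval x = 0)
    (hN : ∀ y : Fin (N + 1) → Ω, (∀ i, y i ∈ Submonoid.closure (insert b (P : Set Ω))) →
      ∃ c : Fin (N + 1) → k1[X], c ≠ 0 ∧ ∑ i, aeval T (c i) * y i = 0) :
    P.card ≤ 4 ^ (3 * N ^ 2) := by
  classical
  obtain ⟨Ok, O, h2, hkO, hPoly⟩ := exists_places b hb
  let φ : Ok →+* O := ((algebraMap k1 Ω).comp Ok.subtype).codRestrict O (fun x => (hkO x).1 x.2)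
  have hφc : ∀ x : Ok, ((φ x : O) : Ω) = algebraMap k1 Ω x := fun _ => rfl
  have hφl : IsLocalHom φ := by
    refine ⟨fun x hx => ?_⟩
    obtain ⟨y, hy⟩ := isUnit_iff_exists_inv.1 hx
    have hy' : algebraMap k1 Ω x * (y : Ω) = 1 := congrArg Subtype.val hy
    have hx0 : (x : k1) ≠ 0 := by
      intro h0
      rw [h0, map_zero, zero_mul] at hy'
      exact zero_ne_one hy'
    have hi : (x : k1)⁻¹ ∈ Ok := by
      rw [hkO, map_inv₀, ← eq_inv_of_mul_eq_one_right hy']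
      exact y.2
    refine isUnit_iff_exists_inv.2 ⟨⟨_, hi⟩, Subtype.ext ?_⟩
    exact mul_inv_cancel₀ hx0
  let κ := IsLocalRing.ResidueField Ok
  let Ω' := AlgebraicClosure (IsLocalRing.ResidueField O)
  let ρk : Ok →+* κ := IsLocalRing.residue Ok
  let ρ : O →+* Ω' := (algebraMap (IsLocalRing.ResidueField O) Ω').comp (IsLocalRing.residue O)
  let ψ : κ →+* Ω' := (algebraMap (IsLocalRing.ResidueField O) Ω').comp (IsLocalRing.ResidueField.map φ)
  let _ : Algebra κ Ω' := ψ.toAlgebra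
  have hψ : ∀ y : κ, algebraMap κ Ω' y = ψ y := fun _ => rfl
  have hρφ : ∀ x, ρ (φ x) = algebraMap κ Ω' (ρk x) := by
    intro x
    rfl
  have hρ0 : ∀ x : O, ρ x = 0 ↔ (x : Ω) ∈ O.nonunits := by
    intro x
    simp only [ρ, RingHom.comp_apply, map_eq_zero]
    rw [IsLocalRing.residue_eq_zero_iff, O.coe_mem_nonunits_iff]
  -- evaluation
  have hev1 : ∀ (t : O) (Q : Ok[X]), ((Q.eval₂ φ t : O) : Ω) = aeval (t : Ω) (Q.map Ok.subtype) := by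
    intro t Q
    have := hom_eval₂ Q φ O.subtype t
    rw [aeval_def, eval₂_map]
    exact this
  have hev2 : ∀ (t : O) (Q : Ok[X]), ρ (Q.eval₂ φ t) = aeval (ρ t) (Q.map ρk) := by
    intro t Q
    rw [hom_eval₂, aeval_def, eval₂_map]
    congr 1
  have hbO : b ∈ O := by
    have := (hPoly X).1
    rwa [map_X, aeval_X] at this
  set b1 : O := ⟨b, hbO⟩ with hb1
  have hbt : Transcendental κ (ρ b1) := by
    rintro ⟨p, hp0, hp⟩
    obtain ⟨Q, rfl⟩ := Polynomial.map_surjective ρk IsLocalRing.residue_surjective p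
    rw [← hev2, hρ0, hev1] at hp
    exact hp0 ((hPoly Q).2.1 hp)
  have hbN := hN (fun i => b ^ (i : ℕ)) (fun i =>
    pow_mem (Submonoid.subset_closure (Set.mem_insert _ _)) _)
  obtain ⟨a, c0, hc0, hT1, hTt⟩ := find_T Ok O ρk ρ (fun x => (hρ0 x).2) (fun x => (hkO x).1)
    (fun x => (hkO x).2) (fun x hx => hρφ ⟨x, hx⟩) b1 hbt T hT N hbN
  set T1 : O := ⟨_, hT1⟩ with hT1d
  have hch : CharP κ 2 := by
    have : (2 : κ) = 0 := by
      have h3 : (2 : Ok) ∈ IsLocalRing.maximalIdeal Ok := by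
        rw [← Ok.coe_mem_nonunits_iff]
        exact h2
      have h4 := (IsLocalRing.residue_eq_zero_iff _).2 h3
      rwa [map_ofNat] at h4
    exact CharTwo.of_one_ne_zero_of_two_eq_zero one_ne_zero this
  have hPO : ∀ x ∈ P, x ∈ O := by
    intro x hx
    have : IsIntegral O x := by
      refine ⟨qF b1 I J, (qF_monic _ I J hJ).1, ?_⟩
      rw [← eval_map, qF_map]
      exact hP x hx
    obtain ⟨y, rfl⟩ := IsIntegrallyClosed.isIntegral_iff.1 this
    exact y.2
  have hroot : ∀ x (hx : x ∈ P), (qF b1 I J).eval ⟨x, hPO x hx⟩ = 0 := by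
    intro x hx
    apply Subtype.ext
    have h3 := hP x hx
    have h4 : qF b I J = (qF b1 I J).map O.subtype := by rw [qF_map]; rfl
    rw [h4, eval_map] at h3
    have h5 := eval₂_hom (p := qF b1 I J) O.subtype ⟨x, hPO x hx⟩
    exact h5.symm.trans h3
  let P' : Finset Ω' := P.attach.image (fun x : {x // x ∈ P} => ρ ⟨x.1, hPO x.1 x.2⟩)
  have : Fact (Nat.Prime 2) := ⟨Nat.prime_two⟩
  have hsep := qF_separable κ 2 I J hJ (ρ b1) hbt
  have hcard : P'.card = P.card := by
    rw [Finset.card_image_of_injective, Finset.card_attach]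
    rintro ⟨x, hx⟩ ⟨y, hy⟩ hxy
    by_contra hne
    have hne' : (⟨y, hPO y hy⟩ : O) - ⟨x, hPO x hx⟩ ≠ 0 := by
      intro h
      apply hne
      have := congrArg Subtype.val (sub_eq_zero.1 h)
      exact Subtype.ext this.symm
    simp only at hxy
    have rx := hroot x hx
    have ry := hroot y hy
    generalize (⟨x, hPO x hx⟩ : O) = X1 at *
    generalize (⟨y, hPO y hy⟩ : O) = Y1 at *
    obtain ⟨G, hG⟩ := dvd_iff_isRoot.2 (show (qF b1 I J).IsRoot X1 from rx)
    rw [hG, eval_mul, eval_sub, eval_X, eval_C] at ry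
    have hGy : G.eval Y1 = 0 := (mul_eq_zero.1 ry).resolve_left hne'
    have hmap : qF (ρ b1) I J = (X - C (ρ X1)) * G.map ρ := by
      rw [← qF_map, hG, Polynomial.map_mul, Polynomial.map_sub, map_X, map_C]
    have hG' : (G.map ρ).eval (ρ X1) = 0 := by
      rw [hxy, eval_map, eval₂_hom, hGy, map_zero]
    have hd : (qF (ρ b1) I J).derivative.eval (ρ X1) = 0 := by
      rw [hmap, derivative_mul]
      simp [hG']
    have := hsep.eval₂_derivative_ne_zero (RingHom.id Ω') (x := ρ X1) (by
      rw [← eval_map, Polynomial.map_id, hmap, eval_mul, eval_sub, eval_X, eval_C, sub_self, zero_mul])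
    rw [← eval_map, Polynomial.map_id] at this
    exact this hd
  have hP' : ∀ x ∈ P', (qF (ρ b1) I J).eval x = 0 := by
    intro x hx
    obtain ⟨⟨z, hz⟩, -, rfl⟩ := Finset.mem_image.1 hx
    rw [← qF_map, eval_map, eval₂_hom, hroot z hz, map_zero]
  have hN' : ∀ y : Fin (N + 1) → Ω', (∀ i, y i ∈ Submonoid.closure (insert (ρ b1) (P' : Set Ω'))) →
      ∃ c : Fin (N + 1) → κ[X], c ≠ 0 ∧ ∑ i, aeval (ρ T1) (c i) * y i = 0 := by
    intro y hy
    have hset : insert (ρ b1) (P' : Set Ω') = ρ '' (insert b1 {x : O | (x : Ω) ∈ P}) := by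
      rw [Set.image_insert_eq]
      congr 1
      ext x
      constructor
      · intro hx
        obtain ⟨⟨z, hz⟩, -, rfl⟩ := Finset.mem_image.1 (Finset.mem_coe.1 hx)
        exact ⟨⟨z, hPO z hz⟩, hz, rfl⟩
      · rintro ⟨z, hz, rfl⟩
        exact Finset.mem_coe.2 (Finset.mem_image.2 ⟨⟨z, hz⟩, Finset.mem_attach _ _, rfl⟩)
    have hcl : Submonoid.closure (insert (ρ b1) (P' : Set Ω')) =
        (Submonoid.closure (insert b1 {x : O | (x : Ω) ∈ P})).map (ρ : O →* Ω') := by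
      rw [MonoidHom.map_mclosure, hset]; rfl
    have hz : ∀ i, ∃ z : O, (z : Ω) ∈ Submonoid.closure (insert b (P : Set Ω)) ∧ ρ z = y i := by
      intro i
      have := hy i
      rw [hcl] at this
      obtain ⟨z, hz, hzy⟩ := this
      refine ⟨z, ?_, hzy⟩
      have h3 : (z : Ω) ∈ (Submonoid.closure (insert b1 {x : O | (x : Ω) ∈ P})).map
          (O.subtype : O →* Ω) := ⟨z, hz, rfl⟩
      rw [MonoidHom.map_mclosure] at h3
      refine Submonoid.closure_mono ?_ h3
      rintro _ ⟨w, hw, rfl⟩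
      rcases hw with rfl | hw
      · exact Set.mem_insert _ _
      · exact Set.mem_insert_of_mem _ hw
    choose z hz1 hz2 using hz
    obtain ⟨c, hcne, hc⟩ := hN (fun i => (z i : Ω)) hz1
    have hTT : aeval (T1 : Ω) (C c0 * X + C a : k1[X]) = T := by
      have : algebraMap k1 Ω c0 ≠ 0 := (_root_.map_ne_zero _).2 hc0
      simp only [map_add, map_mul, aeval_C, aeval_X, hT1d]
      rw [mul_div_cancel₀ _ this]; ring
    have hd : ∀ i, aeval (T1 : Ω) ((c i).comp (C c0 * X + C a)) = aeval T (c i) := by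
      intro i
      rw [aeval_comp, hTT]
    obtain ⟨s, hs, e, he, i1, m1, hem⟩ := scale_family Ok (fun i => (c i).comp (C c0 * X + C a)) (by
      intro h
      apply hcne
      funext i
      by_contra h3
      apply hT
      refine ⟨c i, h3, ?_⟩
      rw [← hd i, congrFun h i, Pi.zero_apply, map_zero])
    refine ⟨fun i => (e i).map ρk, ?_, ?_⟩
    · intro h
      have h3 := congrArg (fun Q => coeff Q m1) (congrFun h i1)
      simp only [coeff_map, hem, map_one, Pi.zero_apply, coeff_zero] at h3
      exact one_ne_zero h3
    · have h3 : ∑ i, (e i).eval₂ φ T1 * z i = 0 := by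
        apply Subtype.ext
        rw [AddSubmonoidClass.coe_finsetSum]
        simp only [MulMemClass.coe_mul, ZeroMemClass.coe_zero, hev1, he, map_mul, aeval_C, hd]
        simp only [mul_assoc, ← Finset.mul_sum, hc, mul_zero]
      have h4 := congrArg ρ h3
      rw [map_sum, map_zero] at h4
      rw [← h4]
      refine Finset.sum_congr rfl fun i _ => ?_
      rw [map_mul, hev2, hz2]
  have := coreP κ 2 I J hJ (ρ b1) (ρ T1) hbt hTt N P' hP' hN'
  rwa [hcard] at this


theorem core_any (k : Type) [Field k] (N : ℕ) : ∃ B0 : ℕ, ∀ (Ω : Type) [Field Ω] [IsAlgClosed Ω]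
    [Algebra k Ω] (b T : Ω), Transcendental k b → Transcendental k T → ∀ P : Finset Ω,
    (∀ x ∈ P, (Set.range fun n : ℕ => (fun z => z ^ 2 + b * z)^[n] x).Finite) →
    (∀ y : Fin (N + 1) → Ω, (∀ i, y i ∈ Submonoid.closure (insert b (P : Set Ω))) →
      ∃ c : Fin (N + 1) → k[X], c ≠ 0 ∧ ∑ i, aeval T (c i) * y i = 0) →
    P.card ≤ B0 := by
  obtain ⟨p, hp⟩ := CharP.exists k
  rcases CharP.char_is_prime_or_zero k p with hpp | rfl
  · refine ⟨4 ^ ((p + 1) * N ^ 2), ?_⟩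
    intro Ω _ _ _ b T hb hT P hP hN
    obtain ⟨I, J, hJ, hIJ⟩ := common_IJ _ P hP
    have : Fact p.Prime := ⟨hpp⟩
    refine coreP k p I J hJ b T hb hT N P (fun x hx => ?_) hN
    rw [qF_eval, hIJ x hx, sub_self]
  · refine ⟨4 ^ (3 * N ^ 2), ?_⟩
    intro Ω _ _ _ b T hb hT P hP hN
    obtain ⟨I, J, hJ, hIJ⟩ := common_IJ _ P hP
    have : CharZero k := CharP.charP_to_charZero k
    let k1 := algebraicClosure k Ω
    have hac : IsAlgClosed k1 := IsAlgClosure.isAlgClosed k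
    have hcz : CharZero k1 := charZero_of_injective_algebraMap (algebraMap k k1).injective
    have htr : ∀ x : Ω, Transcendental k x → Transcendental k1 x := by
      intro x hx hx1
      have : Algebra.IsAlgebraic k k1 := inferInstance
      exact hx (hx1.restrictScalars k)
    refine core0 (k1 := k1) I J hJ b T (htr b hb) (htr T hT) N P (fun x hx => ?_) ?_
    · rw [qF_eval, hIJ x hx, sub_self]
    · intro y hy
      obtain ⟨c, hc0, hc⟩ := hN y hy
      refine ⟨fun i => (c i).map (algebraMap k k1), ?_, ?_⟩
      · intro h
        apply hc0
        funext i
        have := congrFun h i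
        exact (Polynomial.map_eq_zero_iff (algebraMap k k1).injective).1 this
      · rw [← hc]
        refine Finset.sum_congr rfl fun i _ => ?_
        rw [aeval_map_algebraMap]

lemma gon_of_finrank {k Ω : Type*} [Field k] [Field Ω] [Algebra (RatFunc k) Ω] [Algebra k Ω]
    [IsScalarTower k (RatFunc k) Ω] (W : Submodule (RatFunc k) Ω) [FiniteDimensional (RatFunc k) W]
    (N : ℕ) (hW : Module.finrank (RatFunc k) W ≤ N) (y : Fin (N + 1) → Ω) (hy : ∀ i, y i ∈ W) :
    ∃ c : Fin (N + 1) → k[X], c ≠ 0 ∧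
      ∑ i, aeval (algebraMap (RatFunc k) Ω RatFunc.X) (c i) * y i = 0 := by
  classical
  have hnl : ¬ LinearIndependent (RatFunc k) (fun i => (⟨y i, hy i⟩ : W)) := by
    intro h
    have := h.fintype_card_le_finrank
    rw [Fintype.card_fin] at this
    omega
  rw [Fintype.not_linearIndependent_iff] at hnl
  obtain ⟨g, hg, i0, hi0⟩ := hnl
  obtain ⟨d, hd⟩ := IsLocalization.exist_integer_multiples_of_finite (nonZeroDivisors k[X]) g
  choose c hc using hd
  have hd0 : algebraMap k[X] (RatFunc k) d ≠ 0 :=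
    IsFractionRing.to_map_ne_zero_of_mem_nonZeroDivisors d.2
  have hae : ∀ Q : k[X], aeval (algebraMap (RatFunc k) Ω RatFunc.X) Q =
      algebraMap (RatFunc k) Ω (algebraMap k[X] (RatFunc k) Q) := by
    intro Q
    rw [aeval_algebraMap_apply, ← RatFunc.algebraMap_X, aeval_algebraMap_apply, aeval_X_left_apply]
  refine ⟨c, ?_, ?_⟩
  · intro h
    have := hc i0
    rw [h, Pi.zero_apply, map_zero, Algebra.smul_def] at this
    exact mul_ne_zero hd0 hi0 this.symm
  · have h1 : ∑ i, g i • y i = 0 := by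
      have := congrArg Subtype.val hg
      simpa using this
    have h2 : ∀ i, aeval (algebraMap (RatFunc k) Ω RatFunc.X) (c i) * y i =
        algebraMap (RatFunc k) Ω (algebraMap k[X] (RatFunc k) d) * (g i • y i) := by
      intro i
      rw [hae, hc i, Algebra.smul_def, Algebra.smul_def, map_mul]; ring
    simp only [h2, ← Finset.mul_sum, h1, mul_zero]

lemma final_step (k : Type) [Field k]
    (K : Type) [Field K] [Algebra (RatFunc k) K] [FiniteDimensional (RatFunc k) K]
    (D : ℕ) (B0 : ℕ) (N : ℕ) (hNdef : N = 2 * D * Module.finrank (RatFunc k) K)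
    (hB0 : ∀ (Ω : Type) [Field Ω] [IsAlgClosed Ω]
    [Algebra k Ω] (b T : Ω), Transcendental k b → Transcendental k T → ∀ P : Finset Ω,
    (∀ x ∈ P, (Set.range fun n : ℕ => (fun z => z ^ 2 + b * z)^[n] x).Finite) →
    (∀ y : Fin (N + 1) → Ω, (∀ i, y i ∈ Submonoid.closure (insert b (P : Set Ω))) →
      ∃ c : Fin (N + 1) → k[X], c ≠ 0 ∧ ∑ i, aeval T (c i) * y i = 0) →
    P.card ≤ B0)
    (L : Type) [Field L] [Algebra K L] [FiniteDimensional K L]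
    (hD : Module.finrank K L ≤ D) (f : Polynomial L) (hf : f.degree = 2)
    (hiso : ¬ ∃ a b : AlgebraicClosure L, a ≠ 0 ∧
        ∀ n, AlgebraicOver ((algebraMap L (AlgebraicClosure L)).comp ((algebraMap K L).comp
          ((algebraMap (RatFunc k) K).comp RatFunc.C)))
          ((C a⁻¹ * ((f.map (algebraMap L (AlgebraicClosure L))).comp (C a * X + C b) - C b)).coeff n))
    (Q : Finset L) (hQ : ∀ x ∈ Q, (Set.range fun n : ℕ => (fun z => f.eval z)^[n] x).Finite) :
    Q.card ≤ B0 := by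
  classical
  let Ω := AlgebraicClosure L
  let _ : Algebra (RatFunc k) L := ((algebraMap K L).comp (algebraMap (RatFunc k) K)).toAlgebra
  have t1 : IsScalarTower (RatFunc k) K L := IsScalarTower.of_algebraMap_eq fun _ => rfl
  let _ : Algebra k Ω := ((algebraMap L (AlgebraicClosure L)).comp ((algebraMap K L).comp
          ((algebraMap (RatFunc k) K).comp RatFunc.C))).toAlgebra
  have t2 : IsScalarTower (RatFunc k) L Ω := inferInstance
  have t3 : IsScalarTower k (RatFunc k) Ω := IsScalarTower.of_algebraMap_eq fun x => by
    rw [IsScalarTower.algebraMap_apply (RatFunc k) L Ω]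
    rfl
  have fd1 : FiniteDimensional (RatFunc k) L := FiniteDimensional.trans (RatFunc k) K L
  have halg : ∀ x : Ω, IsAlgebraic k x → AlgebraicOver ((algebraMap L (AlgebraicClosure L)).comp ((algebraMap K L).comp
          ((algebraMap (RatFunc k) K).comp RatFunc.C))) x := by
    rintro x ⟨p, hp0, hp⟩
    refine ⟨p, hp0, ?_⟩
    rw [aeval_def, ← eval_map] at hp
    exact hp
  set j := algebraMap L Ω with hj
  obtain ⟨α, hα⟩ : ∃ α, f.coeff 2 = α := ⟨_, rfl⟩
  obtain ⟨β, hβ⟩ : ∃ α, f.coeff 1 = α := ⟨_, rfl⟩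
  obtain ⟨δ, hδ⟩ : ∃ α, f.coeff 0 = α := ⟨_, rfl⟩
  have hfe : f = C α * X ^ 2 + C β * X + C δ := by
    rw [← hα, ← hβ, ← hδ]
    exact eq_quadratic_of_degree_le_two hf.le
  have hα0 : α ≠ 0 := by
    rw [← hα]
    exact coeff_ne_zero_of_eq_degree hf
  have hjα : j α ≠ 0 := (_root_.map_ne_zero j).2 hα0
  -- the fixed point
  let F : L[X] := C α * X ^ 2 + C (β - 1) * X + C δ
  have hFdeg : F.natDegree = 2 := natDegree_quadratic hα0
  obtain ⟨s, hs⟩ := IsAlgClosed.exists_aeval_eq_zero Ω F (by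
    intro h
    have := natDegree_eq_of_degree_eq_some h
    rw [hFdeg] at this
    exact absurd this (by norm_num))
  have hs' : j α * s ^ 2 + j β * s + j δ = s := by
    simp only [F, map_add, map_mul, aeval_C, aeval_X, map_pow, map_sub, map_one] at hs
    linear_combination hs
  have hF0 : F ≠ 0 := by
    intro h
    rw [h] at hFdeg
    simp at hFdeg
  have hsalg : IsAlgebraic L s := ⟨F, hF0, hs⟩
  set b : Ω := 2 * j α * s + j β with hb
  have hbt : Transcendental k b := by
    intro hba
    apply hiso
    refine ⟨(j α)⁻¹, s, inv_ne_zero hjα, fun n => halg _ ?_⟩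
    have e : C (j α)⁻¹⁻¹ * ((f.map j).comp (C (j α)⁻¹ * X + C s) - C s) = X ^ 2 + C b * X := by
      rw [hfe]
      simp only [Polynomial.map_add, Polynomial.map_mul, map_C, Polynomial.map_pow, map_X, add_comp, mul_comp,
        C_comp, pow_comp, X_comp]
      have h1 : C (j α) * C ((j α)⁻¹) = 1 := by rw [← C_mul, mul_inv_cancel₀ hjα, C_1]
      have h2 : C (j α) * C s ^ 2 + C (j β) * C s + C (j δ) = C s := by
        simp only [← C_mul, ← C_pow, ← C_add, hs']
      have h3 : C b = 2 * C (j α) * C s + C (j β) := by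
        rw [hb]; simp only [C_add, C_mul]; rfl
      have h4 : C ((j α)⁻¹⁻¹) = C (j α) := congrArg C (inv_inv (j α))
      rw [h3, h4]
      linear_combination (C (j α)) * h2 + (X ^ 2 * (C (j α) * C ((j α)⁻¹) + 1) + (2 * C (j α) * C s + C (j β)) * X) * h1
    have e' : (C (j α)⁻¹⁻¹ * ((f.map j).comp (C (j α)⁻¹ * X + C s) - C s)).coeff n =
      (X ^ 2 + C b * X).coeff n := by rw [e]
    refine e' ▸ ?_
    rw [coeff_add, coeff_X_pow, coeff_C_mul, coeff_X]
    refine IsAlgebraic.add ?_ (IsAlgebraic.mul hba ?_)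
    · split_ifs
      · exact isAlgebraic_one
      · exact isAlgebraic_zero
    · split_ifs
      · exact isAlgebraic_one
      · exact isAlgebraic_zero
  set T : Ω := algebraMap (RatFunc k) Ω RatFunc.X with hT
  have hTt : Transcendental k T := by
    rintro ⟨p, hp0, hp⟩
    rw [hT, aeval_algebraMap_apply, ← RatFunc.algebraMap_X, aeval_algebraMap_apply, aeval_X_left_apply,
      map_eq_zero] at hp
    exact hp0 (RatFunc.algebraMap_injective k (by rw [hp, map_zero]))
  let m : L → Ω := fun x => j α * (j x - s)
  have hminj : Function.Injective m := by
    intro x y hxy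
    have := mul_left_cancel₀ hjα hxy
    exact j.injective (sub_left_injective this)
  have hsemi : ∀ x, m (f.eval x) = m x ^ 2 + b * m x := by
    intro x
    simp only [m, hb]
    rw [hfe]
    simp only [eval_add, eval_mul, eval_C, eval_pow, eval_X, map_add, map_mul, map_pow]
    linear_combination (j α) * hs'
  have hiter : ∀ (n : ℕ) x, m ((fun z => f.eval z)^[n] x) = (fun z => z ^ 2 + b * z)^[n] (m x) := by
    intro n
    induction n with
    | zero => intro x; rfl
    | succ n ih =>
      intro x
      rw [Function.iterate_succ_apply, Function.iterate_succ_apply, ih, hsemi]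
  rw [← Finset.card_image_of_injective Q hminj]
  refine hB0 Ω b T hbt hTt _ ?_ ?_
  · intro x hx
    obtain ⟨z, hz, rfl⟩ := Finset.mem_image.1 hx
    simp only [← hiter]
    have := (hQ z hz).image m
    rwa [← Set.range_comp] at this
  · intro y hy
    let L' := IntermediateField.adjoin L ({s} : Set Ω)
    have hint : IsIntegral L s := hsalg.isIntegral
    have fd2 : FiniteDimensional L L' := IntermediateField.adjoin.finiteDimensional hint
    have hfr : Module.finrank L L' ≤ 2 := by
      rw [IntermediateField.adjoin.finrank hint, ← hFdeg]
      exact natDegree_le_of_dvd (minpoly.dvd L s hs) hF0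
    let W : Submodule (RatFunc k) Ω := (Subalgebra.toSubmodule L'.toSubalgebra).restrictScalars (RatFunc k)
    have t4 : IsScalarTower (RatFunc k) L L' := IsScalarTower.of_algebraMap_eq fun _ => rfl
    have fd3 : FiniteDimensional (RatFunc k) L' := FiniteDimensional.trans (RatFunc k) L L'
    have fdW : FiniteDimensional (RatFunc k) W := fd3
    have hWfr : Module.finrank (RatFunc k) W = Module.finrank (RatFunc k) L' := rfl
    have hWN : Module.finrank (RatFunc k) W ≤ N := by
      rw [hWfr, ← Module.finrank_mul_finrank (RatFunc k) L L', ← Module.finrank_mul_finrank (RatFunc k) K L, hNdef]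
      calc _ ≤ Module.finrank (RatFunc k) K * D * 2 := by gcongr
        _ = _ := by ring
    refine gon_of_finrank W N hWN y ?_
    have hsL : s ∈ L' := IntermediateField.subset_adjoin L _ rfl
    have hjL : ∀ x, j x ∈ L' := fun x => L'.algebraMap_mem x
    have hcl : Submonoid.closure (insert b ((Q.image m : Finset Ω) : Set Ω)) ≤ L'.toSubalgebra.toSubmonoid := by
      rw [Submonoid.closure_le]
      rintro x (rfl | hx)
      · show _ ∈ L'
        exact add_mem (mul_mem (mul_mem (ofNat_mem L' 2) (hjL _)) hsL) (hjL _)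
      · obtain ⟨z, -, rfl⟩ := Finset.mem_image.1 (Finset.mem_coe.1 hx)
        show _ ∈ L'
        exact mul_mem (hjL _) (sub_mem (hjL _) hsL)
    exact fun i => hcl (hy i)
/-- Corollary 1.2 of Doyle–Faber.  Let `k` be any field and `K` a function
field over `k`.  For each `D ≥ 1` there is a bound `B` such that for every extension `L/K` of
degree at most `D` and every quadratic polynomial `f ∈ L[z]` that is not conjugate, by an affine
map `γ(z) = az + b` with `a, b` in an algebraic closure `L̄` of `L`, `a ≠ 0`, to a polynomial with
coefficients in the algebraic closure of `k` inside `L̄`, the number of preperiodic points of `f`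
in `P¹(L)` is at most `B`. -/
theorem strong_uniform_boundedness_quadratic
    (k : Type) [Field k]
    (K : Type) [Field K] [Algebra (RatFunc k) K] [FiniteDimensional (RatFunc k) K]
    (D : ℕ) (hD : 1 ≤ D) :
    ∃ B : ℕ, ∀ (L : Type) [Field L] [Algebra K L] [FiniteDimensional K L],
      Module.finrank K L ≤ D → ∀ f : Polynomial L, f.degree = 2 →
      let ι : k →+* AlgebraicClosure L :=
        (algebraMap L (AlgebraicClosure L)).comp ((algebraMap K L).comp
          ((algebraMap (RatFunc k) K).comp RatFunc.C));
      let fbar : Polynomial (AlgebraicClosure L) := f.map (algebraMap L (AlgebraicClosure L));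
      (¬ ∃ a b : AlgebraicClosure L, a ≠ 0 ∧
        ∀ n, AlgebraicOver ι ((C a⁻¹ * (fbar.comp (C a * X + C b) - C b)).coeff n)) →
      ({x : Option L | IsPreperiodic (polyP1Map f) x}.Finite ∧
        {x : Option L | IsPreperiodic (polyP1Map f) x}.ncard ≤ B) := by
  obtain ⟨B0, hB0⟩ := core_any k (2 * D * Module.finrank (RatFunc k) K)
  refine ⟨B0 + 1, ?_⟩
  intro L _ _ _ hL f hf
  intro ι fbar hiso
  have hfin := final_step k K D B0 _ rfl hB0 L hL f hf hiso
  have hsome : ∀ (n : ℕ) (x : L), (polyP1Map f)^[n] (some x) = some ((fun z => f.eval z)^[n] x) := by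
    intro n
    induction n with
    | zero => intro x; rfl
    | succ n ih =>
      intro x
      rw [Function.iterate_succ_apply, Function.iterate_succ_apply]
      exact ih _
  have hpre : ∀ x : L, IsPreperiodic (polyP1Map f) (some x) →
      (Set.range fun n : ℕ => (fun z => f.eval z)^[n] x).Finite := by
    intro x hx
    unfold IsPreperiodic at hx
    simp only [hsome] at hx
    have e : (Set.range fun n : ℕ => some ((fun z => f.eval z)^[n] x)) =
        some '' (Set.range fun n : ℕ => (fun z => f.eval z)^[n] x) := by
      rw [← Set.range_comp]; rfl
    rw [e] at hx
    exact hx.of_finite_image (Option.some_injective _).injOn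
  let S' : Set L := {x : L | IsPreperiodic (polyP1Map f) (some x)}
  have hS'fin : S'.Finite := by
    by_contra h
    obtain ⟨t, ht, hc⟩ := Set.Infinite.exists_subset_card_eq h (B0 + 1)
    have := hfin t (fun x hx => hpre x (ht hx))
    omega
  have hS'card : S'.ncard ≤ B0 := by
    rw [Set.ncard_eq_toFinset_card _ hS'fin]
    exact hfin _ (fun x hx => hpre x (hS'fin.mem_toFinset.1 hx))
  have hsub : {x : Option L | IsPreperiodic (polyP1Map f) x} ⊆ insert none (some '' S') := by
    rintro (_ | x) hx
    · exact Set.mem_insert _ _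
    · exact Set.mem_insert_of_mem _ ⟨x, hx, rfl⟩
  have hfin2 : (insert none (some '' S') : Set (Option L)).Finite := (hS'fin.image _).insert _
  refine ⟨hfin2.subset hsub, ?_⟩
  calc _ ≤ _ := Set.ncard_le_ncard hsub hfin2
    _ ≤ (some '' S').ncard + 1 := Set.ncard_insert_le _ _
    _ ≤ _ := Nat.add_le_add_right ((Set.ncard_image_le hS'fin).trans hS'card) 1
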